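/- arXiv:2603.30017 — 4 statements merged into one kernel-verified Lean document; each statement's English description precedes it below -/
import Mathlib

section
/- For every ε ∈ (0,1/4) and every q ∈ (0,1/2], δ_ε(q) ≥ (1/120)·min(√q, q/√ε). -/
/-- `δ_ε(q) = ∫₀¹ x^(1/q−1) · min((1−x)^(−1/2), ε^(−1/2)) dx − q(2−√ε)`. -/
noncomputable def deltaEps (ε q : ℝ) : ℝ :=
  (∫ x in (0:ℝ)..1, x ^ (1 / q - 1) * min ((1 - x) ^ (-(1:ℝ)/2)) (ε ^ (-(1:ℝ)/2)))
    - q * (2 - Real.sqrt ε)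

open intervalIntegral MeasureTheory

lemma aux_point (q m x : ℝ) (hq : 0 < q) (hq2 : q ≤ 1/2) (hqm : q ≤ m) (hm : m ≤ 1/2)
    (h1 : 1 - 3/2*m ≤ x) (h2 : x ≤ 1 - m) :
    q / (45 * m * √m) ≤ (q * x - q * x ^ (1/q)) * (1/2 * (1-x)^(-(3:ℝ)/2)) := by
  have hm0 : 0 < m := by linarith
  have hx : 1/4 ≤ x := by linarith
  have hx0 : 0 < x := by linarith
  have e1 : x ^ (1/q - 1) ≤ 2/3 := by
    have hb : 0 ≤ 1/q - 1 := by
      rw [sub_nonneg, le_div_iff₀ hq]; linarith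
    have : x ≤ Real.exp (x - 1) := by have := Real.add_one_le_exp (x-1); linarith
    calc x ^ (1/q - 1) ≤ (Real.exp (x-1)) ^ (1/q-1) := Real.rpow_le_rpow hx0.le this hb
      _ = Real.exp ((x-1) * (1/q-1)) := by rw [← Real.exp_mul]
      _ ≤ Real.exp (-(1/2)) := by
        apply Real.exp_le_exp.mpr
        have : q * (1/q-1) = 1 - q := by field_simp
        nlinarith
      _ ≤ 2/3 := by
        rw [Real.exp_neg]
        have := Real.add_one_le_exp (1/2:ℝ)
        rw [inv_le_comm₀ (by positivity) (by norm_num)]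
        linarith
  have e2 : x ^ (1/q) = x ^ (1/q - 1) * x := by
    rw [← Real.rpow_add_one hx0.ne']; congr 1; ring
  have e3 : q / 12 ≤ q * x - q * x ^ (1/q) := by
    rw [e2]
    have : x * (1/3) ≤ x * (1 - x^(1/q-1)) := by gcongr; linarith
    nlinarith
  have ht : 0 < 1 - x := by linarith
  have e4 : (1-x)^(-(3:ℝ)/2) = ((1-x) * √(1-x))⁻¹ := by
    rw [show (-(3:ℝ)/2) = -(1 + 1/2) by norm_num, Real.rpow_neg ht.le, Real.rpow_add ht,
      Real.rpow_one, Real.sqrt_eq_rpow]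
  have e5 : √(1-x) ≤ 5/4 * √m := by
    rw [Real.sqrt_le_left (by positivity), mul_pow, Real.sq_sqrt hm0.le]; linarith
  have hs : 0 < √m := Real.sqrt_pos.mpr hm0
  have hs' : 0 < √(1-x) := Real.sqrt_pos.mpr ht
  have e6 : (1-x) * √(1-x) ≤ (3/2*m) * (5/4 * √m) := by
    apply mul_le_mul _ e5 hs'.le (by positivity); linarith
  calc q / (45 * m * √m) = q/12 * (1/2 * ((3/2*m) * (5/4 * √m))⁻¹) := by field_simp; norm_num
    _ ≤ _ := by
      rw [e4]
      apply mul_le_mul e3 _ (by positivity) (by linarith)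
      gcongr

lemma aux_eq (ε q : ℝ) (h0 : 0 < ε) (h1 : ε < 1/4) (hq : 0 < q) (hq2 : q ≤ 1/2) :
    deltaEps ε q = ∫ x in (0:ℝ)..(1-ε),
      (q * x - q * x ^ (1/q)) * (1/2 * (1-x)^(-(3:ℝ)/2)) := by
  have ha : 2 ≤ 1/q := by rw [le_div_iff₀ hq]; linarith
  have hs : 0 < √ε := Real.sqrt_pos.mpr h0
  have hr : ε ^ (-(1:ℝ)/2) = (√ε)⁻¹ := by
    rw [neg_div, Real.rpow_neg h0.le, Real.sqrt_eq_rpow]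
  have hle : (0:ℝ) ≤ 1 - ε := by linarith
  set g : ℝ → ℝ := fun x => x ^ (1 / q - 1) * min ((1 - x) ^ (-(1:ℝ)/2)) (ε ^ (-(1:ℝ)/2)) with hg
  have hc : Continuous fun x : ℝ => x ^ (1/q-1) := Real.continuous_rpow_const (by linarith)
  have hca : Continuous fun x : ℝ => x ^ (1/q) := Real.continuous_rpow_const (by linarith)
  have hcp : ∀ p : ℝ, ContinuousOn (fun x : ℝ => (1-x)^p) (Set.uIcc 0 (1-ε)) := by
    intro p
    apply ContinuousOn.rpow_const (by fun_prop)
    intro x hx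
    rw [Set.uIcc_of_le hle] at hx
    left; have := hx.2; intro h; linarith
  have d1 : ∀ x ∈ Set.uIcc (0:ℝ) (1-ε),
      HasDerivAt (fun x : ℝ => (1-x)^(-(1:ℝ)/2)) (1/2 * (1-x)^(-(3:ℝ)/2)) x := by
    intro x hx
    rw [Set.uIcc_of_le hle] at hx
    have hx2 := hx.2
    have := ((hasDerivAt_id' x).const_sub 1).rpow_const (p := -(1:ℝ)/2)
      (Or.inl (by intro h; linarith))
    refine this.congr_deriv ?_
    rw [show (-(1:ℝ)/2 - 1) = -(3:ℝ)/2 by norm_num]; ring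
  have d1' : ∀ x ∈ Set.uIcc (0:ℝ) (1-ε),
      HasDerivAt (fun x : ℝ => -2 * (1-x)^((1:ℝ)/2)) ((1-x)^(-(1:ℝ)/2)) x := by
    intro x hx
    rw [Set.uIcc_of_le hle] at hx
    have hx2 := hx.2
    have := (((hasDerivAt_id' x).const_sub 1).rpow_const (p := (1:ℝ)/2)
      (Or.inl (by intro h; linarith))).const_mul (-2)
    refine this.congr_deriv ?_
    rw [show ((1:ℝ)/2 - 1) = -(1:ℝ)/2 by norm_num]; ring
  have d2 : ∀ x : ℝ, HasDerivAt (fun x : ℝ => q * x ^ (1/q) - q * x) (x ^ (1/q-1) - q) x := by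
    intro x
    have := ((Real.hasDerivAt_rpow_const (x := x) (p := 1/q) (Or.inr (by linarith))).const_mul q).sub
      ((hasDerivAt_id' x).const_mul q)
    refine this.congr_deriv ?_
    have : q * (1/q * x^(1/q-1)) = x^(1/q-1) := by
      rw [← mul_assoc, mul_one_div_cancel hq.ne', one_mul]
    rw [this, mul_one]
  have eq1 : Set.EqOn g (fun x => x^(1/q-1) * (1-x)^(-(1:ℝ)/2)) (Set.uIcc 0 (1-ε)) := by
    intro x hx
    rw [Set.uIcc_of_le hle] at hx
    have hx2 := hx.2
    simp only [hg]
    rw [min_eq_left]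
    exact Real.rpow_le_rpow_of_nonpos h0 (by linarith) (by norm_num)
  have eq2 : Set.EqOn g (fun x => x^(1/q-1) * (√ε)⁻¹) (Set.Ioo (1-ε) 1) := by
    intro x hx
    simp only [hg]
    rw [min_eq_right, hr]
    exact Real.rpow_le_rpow_of_nonpos (by linarith [hx.2]) (by linarith [hx.1]) (by norm_num)
  have i1 : IntervalIntegrable g volume 0 (1-ε) := by
    apply ContinuousOn.intervalIntegrable
    exact (hc.continuousOn.mul (hcp _)).congr eq1
  have i2' : IntervalIntegrable (fun x => x^(1/q-1) * (√ε)⁻¹) volume (1-ε) 1 :=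
    (hc.mul continuous_const).intervalIntegrable _ _
  have i2 : IntervalIntegrable g volume (1-ε) 1 := by
    refine i2'.congr_uIoo ?_
    rw [Set.uIoo_of_le (by linarith)]; exact eq2.symm
  have I2 : ∫ x in (1-ε)..1, g x = ∫ x in (1-ε)..1, x^(1/q-1) * (√ε)⁻¹ := by
    apply intervalIntegral.integral_congr_Ioo_of_le (by linarith) eq2
  have I2' : ∫ x in (1-ε)..1, (x^(1/q-1) - q) = -(q * (1-ε)^(1/q) - q * (1-ε)) := by
    rw [integral_eq_sub_of_hasDerivAt (fun x _ => d2 x)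
      ((hc.sub continuous_const).intervalIntegrable _ _)]
    simp
  rw [integral_sub (hc.intervalIntegrable _ _) (continuous_const.intervalIntegrable _ _)] at I2'
  have I1 := integral_mul_deriv_eq_deriv_mul (a := 0) (b := 1-ε) d1 (fun x _ => d2 x)
    ((continuousOn_const.mul (hcp _)).intervalIntegrable)
    ((hc.sub continuous_const).intervalIntegrable _ _)
  have I3 := integral_eq_sub_of_hasDerivAt d1' (hcp _).intervalIntegrable
  have z : (0:ℝ)^(1/q) = 0 := Real.zero_rpow (by linarith)
  have I4 : ∫ x in (0:ℝ)..(1-ε), (1-x)^(-(1:ℝ)/2) * (x^(1/q-1) - q) =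
     (∫ x in (0:ℝ)..(1-ε), g x) - q * ∫ x in (0:ℝ)..(1-ε), (1-x)^(-(1:ℝ)/2) := by
    rw [← intervalIntegral.integral_const_mul, ← integral_sub i1 ((hcp _).intervalIntegrable.const_mul q)]
    apply integral_congr
    intro x hx
    simp only
    rw [eq1 hx]; ring
  have I5 : ∫ x in (0:ℝ)..(1-ε), (q * x - q * x ^ (1/q)) * (1/2 * (1-x)^(-(3:ℝ)/2)) =
     - ∫ x in (0:ℝ)..(1-ε), (1/2 * (1-x)^(-(3:ℝ)/2)) * (q * x ^ (1/q) - q * x) := by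
    rw [← intervalIntegral.integral_neg]
    congr 1; ext x; ring
  unfold deltaEps
  rw [← integral_add_adjacent_intervals i1 i2, I2, intervalIntegral.integral_mul_const, I5]
  rw [I4, I3] at I1
  simp only [sub_sub_cancel, hr, z, ← Real.sqrt_eq_rpow, sub_zero, Real.sqrt_one,
    intervalIntegral.integral_const, smul_eq_mul, mul_zero] at I1 I2'
  have hss : √ε * √ε = ε := Real.mul_self_sqrt h0.le
  have hss' : ε * (√ε)⁻¹ = √ε := by
    field_simp; rw [sq, hss]
  linear_combination I1 + (√ε)⁻¹ * I2' + q * hss'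

/-- For every `ε ∈ (0,1/4)` and every `q ∈ (0,1/2]`,
`δ_ε(q) ≥ (1/120) · min(√q, q/√ε)`. -/
theorem deltaEps_ge_min (ε q : ℝ) (hε : ε ∈ Set.Ioo (0:ℝ) (1/4))
    (hq : q ∈ Set.Ioc (0:ℝ) (1/2)) :
    deltaEps ε q ≥ (1/120) * min (Real.sqrt q) (q / Real.sqrt ε) := by
  obtain ⟨h0, h1⟩ := hε
  obtain ⟨hq0, hq2⟩ := hq
  rw [aux_eq ε q h0 h1 hq0 hq2]
  have ha : 2 ≤ 1/q := by rw [le_div_iff₀ hq0]; linarith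
  obtain ⟨m, hqm, hem, hm, hmin⟩ : ∃ m, q ≤ m ∧ ε ≤ m ∧ m ≤ 1/2 ∧
      min (√q) (q/√ε) ≤ q / √m := by
    rcases le_total q ε with h | h
    · exact ⟨ε, h, le_rfl, by linarith, min_le_right _ _⟩
    · refine ⟨q, le_rfl, h, hq2, (min_le_left _ _).trans ?_⟩
      rw [Real.div_sqrt]
  have hm0 : 0 < m := by linarith
  have hs : 0 < √m := Real.sqrt_pos.mpr hm0
  set h : ℝ → ℝ := fun x => (q * x - q * x ^ (1/q)) * (1/2 * (1-x)^(-(3:ℝ)/2)) with hh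
  have hca : Continuous fun x : ℝ => x ^ (1/q) := Real.continuous_rpow_const (by linarith)
  have hcont : ContinuousOn h (Set.Icc 0 (1-ε)) := by
    apply ContinuousOn.mul (by fun_prop)
    apply continuousOn_const.mul
    apply ContinuousOn.rpow_const (by fun_prop)
    intro x hx
    left; have := hx.2; intro h; linarith
  have hle : (0:ℝ) ≤ 1 - ε := by linarith
  have hii : IntervalIntegrable h volume 0 (1-ε) :=
    ContinuousOn.intervalIntegrable (by rwa [Set.uIcc_of_le hle])
  have hpos : ∀ x ∈ Set.Ioc (0:ℝ) (1-ε), 0 ≤ h x := by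
    intro x hx
    have hx1 : x ≤ 1 := by linarith [hx.2]
    have : x ^ (1/q) ≤ x := by
      have := Real.rpow_le_rpow_of_exponent_ge hx.1 hx1 (show 1 ≤ 1/q by linarith)
      rwa [Real.rpow_one] at this
    apply mul_nonneg
    · have := mul_le_mul_of_nonneg_left this hq0.le
      linarith
    · have := Real.rpow_nonneg (show 0 ≤ 1 - x by linarith) (-(3:ℝ)/2)
      positivity
  have hmono : ∫ x in (1-3/2*m)..(1-m), h x ≤ ∫ x in (0:ℝ)..(1-ε), h x := by
    apply integral_mono_interval (by linarith) (by linarith) (by linarith) _ hii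
    exact (ae_restrict_iff' measurableSet_Ioc).mpr (Filter.Eventually.of_forall hpos)
  have hlow : ∫ x in (1-3/2*m)..(1-m), q / (45 * m * √m) ≤ ∫ x in (1-3/2*m)..(1-m), h x := by
    apply integral_mono_on (by linarith) (by simp)
    · apply ContinuousOn.intervalIntegrable
      rw [Set.uIcc_of_le (by linarith)]
      exact hcont.mono (Set.Icc_subset_Icc (by linarith) (by linarith))
    · intro x hx
      exact aux_point q m x hq0 hq2 hqm hm hx.1 hx.2
  rw [intervalIntegral.integral_const, smul_eq_mul] at hlow
  have : (1 - m - (1 - 3/2*m)) * (q / (45 * m * √m)) = 1/90 * (q / √m) := by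
    field_simp; ring
  have hp : 0 < q / √m := by positivity
  linarith
end

section
/- For every ε ∈ (0,1/4), δ_ε(1/2) ≥ 1/10, i.e. ∫₀¹ x · min((1−x)^{−1/2}, ε^{−1/2}) dx − (2−√ε)/2 ≥ 1/10. -/
/-- For every `ε ∈ (0,1/4)`, `δ_ε(1/2) ≥ 1/10`, i.e.
`∫₀¹ x · min((1−x)^(−1/2), ε^(−1/2)) dx − (2−√ε)/2 ≥ 1/10`. -/
theorem deltaEps_half_ge (ε : ℝ) (hε : ε ∈ Set.Ioo (0:ℝ) (1/4)) :
    (∫ x in (0:ℝ)..1, x * min ((1 - x) ^ (-(1:ℝ)/2)) (ε ^ (-(1:ℝ)/2)))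
      - (2 - Real.sqrt ε) / 2 ≥ 1/10 := by
  obtain ⟨h0, h1⟩ := hε
  set f : ℝ → ℝ := fun y => (1 - y) * min (y ^ (-(1:ℝ)/2)) (ε ^ (-(1:ℝ)/2)) with hf
  have e1 : (∫ x in (0:ℝ)..1, x * min ((1 - x) ^ (-(1:ℝ)/2)) (ε ^ (-(1:ℝ)/2)))
      = ∫ y in (0:ℝ)..1, f y := by
    have := intervalIntegral.integral_comp_sub_left (a := 0) (b := 1) f 1
    simp only [hf, sub_sub_cancel, sub_self, sub_zero] at this
    exact this
  have c1 : Set.EqOn (fun y => (1 - y) * ε ^ (-(1:ℝ)/2)) f (Set.uIoc 0 ε) := by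
    intro y hy
    rw [Set.uIoc_of_le h0.le] at hy
    have : ε ^ (-(1:ℝ)/2) ≤ y ^ (-(1:ℝ)/2) :=
      Real.rpow_le_rpow_of_nonpos hy.1 hy.2 (by norm_num)
    simp only [hf, min_eq_right this]
  have c2 : Set.EqOn (fun y : ℝ => y ^ (-(1:ℝ)/2) - y ^ ((1:ℝ)/2)) f (Set.uIoc ε 1) := by
    intro y hy
    rw [Set.uIoc_of_le (by linarith)] at hy
    have hy0 : 0 < y := h0.trans hy.1
    have : y ^ (-(1:ℝ)/2) ≤ ε ^ (-(1:ℝ)/2) :=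
      Real.rpow_le_rpow_of_nonpos h0 hy.1.le (by norm_num)
    simp only [hf, min_eq_left this]
    have h2 : y ^ ((1:ℝ)/2) = y * y ^ (-(1:ℝ)/2) := by
      rw [← Real.rpow_one_add' hy0.le (by norm_num)]; norm_num
    rw [h2]; ring
  have j1 : IntervalIntegrable (fun y => (1 - y) * ε ^ (-(1:ℝ)/2)) MeasureTheory.volume 0 ε :=
    (by fun_prop : Continuous _).intervalIntegrable _ _
  have j3 : IntervalIntegrable (fun y : ℝ => y ^ (-(1:ℝ)/2)) MeasureTheory.volume ε 1 :=
    intervalIntegral.intervalIntegrable_rpow' (by norm_num)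
  have j4 : IntervalIntegrable (fun y : ℝ => y ^ ((1:ℝ)/2)) MeasureTheory.volume ε 1 :=
    intervalIntegral.intervalIntegrable_rpow' (by norm_num)
  have i1 := j1.congr c1
  have i2 := (j3.sub j4).congr c2
  have s0 : 0 < Real.sqrt ε := Real.sqrt_pos.2 h0
  have ss : Real.sqrt ε * Real.sqrt ε = ε := Real.mul_self_sqrt h0.le
  have p1 : ε ^ ((1:ℝ)/2) = Real.sqrt ε := (Real.sqrt_eq_rpow ε).symm
  have p2 : ε ^ (-(1:ℝ)/2) = (Real.sqrt ε)⁻¹ := by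
    rw [← p1, ← Real.rpow_neg h0.le]; norm_num
  have p3 : ε ^ ((3:ℝ)/2) = ε * Real.sqrt ε := by
    rw [← p1, ← Real.rpow_one_add' h0.le (by norm_num)]; norm_num
  have v1 : ∫ y in (0:ℝ)..ε, f y = (ε - ε^2/2) * (Real.sqrt ε)⁻¹ := by
    rw [← intervalIntegral.integral_congr_ae (Filter.Eventually.of_forall (fun y hy => c1 hy)), intervalIntegral.integral_mul_const, p2,
      intervalIntegral.integral_sub (by simp) (by simp)]
    simp
  have v2 : ∫ y in ε..1, f y = 2 - 2 * Real.sqrt ε - (2/3 - 2/3 * (ε * Real.sqrt ε)) := by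
    rw [← intervalIntegral.integral_congr_ae (Filter.Eventually.of_forall (fun y hy => c2 hy)), intervalIntegral.integral_sub j3 j4,
      integral_rpow (Or.inl (by norm_num)), integral_rpow (Or.inl (by norm_num))]
    rw [show (-(1:ℝ)/2 + 1) = 1/2 by norm_num, show ((1:ℝ)/2 + 1) = 3/2 by norm_num, p1, p3]
    simp only [Real.one_rpow]
    ring
  rw [e1, ← intervalIntegral.integral_add_adjacent_intervals i1 i2, v1, v2]
  have hs : Real.sqrt ε < 1/2 := by nlinarith
  generalize Real.sqrt ε = s at *
  subst ss
  have : (s * s - (s * s)^2/2) * s⁻¹ = s - s^3/2 := by field_simp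
  rw [this]
  nlinarith [mul_pos s0 s0, mul_pos (sub_pos.2 hs) s0, mul_pos (sub_pos.2 hs) (mul_pos s0 s0)]
end

section
/- Let Σ = {1,…,d}, n ≥ 1, δ ∈ (0,1), and set ε = log(1/δ)/n, assumed to satisfy ε ≤ 1/4. Let (Ω, F, P) be a probability space with a filtration (F_t)_{t=0}^n. For each t, let P_t be an F_{t−1}-measurable random probability vector on Σ with all entries positive, and let V_t be an F_t-measurable random variable in [0,1] whose conditional distribution given F_{t−1} satisfies P(V_t ≤ x | F_{t−1}) = Σ_{a∈Σ} P_t(a) x^{1/P_t(a)} almost surely, for every x ∈ [0,1]. Set τ = √(2 n log(1/ε) log(1/δ)) + (3/2)·log(1/δ)/√ε. Then with probability at least 1 − 2δ, Σ_{t=1}^n S_ε(V_t) ≥ (1/480)·Σ_{t=1}^n G_ε(P_t) − 3τ. -/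
open MeasureTheory ProbabilityTheory

/-- The statistic `S_ε(u) = min(1/√ε, 1/√(1−u)) − (2 − √ε)` for `u ∈ [0,1)`,
extended by the value `1/√ε − (2 − √ε)` at `u ≥ 1`. -/
noncomputable def Sstat (ε u : ℝ) : ℝ :=
  (if u < 1 then min (Real.sqrt ε)⁻¹ (Real.sqrt (1 - u))⁻¹ else (Real.sqrt ε)⁻¹)
    - (2 - Real.sqrt ε)

/-- `G^q(p) = ∑_a (p(a)(1−p(a)))^q`. -/
noncomputable def Gq {d : ℕ} (q : ℝ) (p : Fin d → ℝ) : ℝ :=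
  ∑ a, (p a * (1 - p a)) ^ q

/-- `p_ε(a) = p(a)·1(p(a) ≤ ε)`. -/
noncomputable def peps {d : ℕ} (ε : ℝ) (p : Fin d → ℝ) : Fin d → ℝ :=
  fun a => if p a ≤ ε then p a else 0

/-- `p_ε^c(a) = p(a)·1(p(a) > ε)`. -/
noncomputable def pepsC {d : ℕ} (ε : ℝ) (p : Fin d → ℝ) : Fin d → ℝ :=
  fun a => if ε < p a then p a else 0

/-- `G_ε(p) = G^1(p_ε)/√ε + G^{1/2}(p_ε^c)`. -/
noncomputable def Geps {d : ℕ} (ε : ℝ) (p : Fin d → ℝ) : ℝ :=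
  Gq 1 (peps ε p) / Real.sqrt ε + Gq (1/2) (pepsC ε p)


lemma mart_aux {Ω : Type*} {m0 : MeasurableSpace Ω} (μ : Measure Ω) [IsProbabilityMeasure μ]
    (ℱ : Filtration ℕ m0) (Y : ℕ → Ω → ℝ) (B : ℕ → ℝ) 
    (hY0 : ∀ k ω, 0 ≤ Y k ω) (hYB : ∀ k ω, Y k ω ≤ B k)
    (hYm : ∀ k, Measurable[ℱ (k+1)] (Y k))
    (hstep : ∀ k (M : Ω → ℝ) (K : ℝ), (∀ ω, 0 ≤ M ω) → (∀ ω, M ω ≤ K) → Measurable[ℱ k] M →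
      ∫ ω, M ω * Y k ω ∂μ ≤ ∫ ω, M ω ∂μ) (k : ℕ) :
    ∫ ω, ∏ i ∈ Finset.range k, Y i ω ∂μ ≤ 1 := by
  induction k with
  | zero => simp
  | succ k ih =>
    simp only [Finset.prod_range_succ]
    refine (hstep k _ (∏ i ∈ Finset.range k, B i) ?_ ?_ ?_).trans ih
    · intro ω; exact Finset.prod_nonneg fun i _ => hY0 i ω
    · intro ω; exact Finset.prod_le_prod (fun i _ => hY0 i ω) (fun i _ => hYB i ω)
    · refine Finset.measurable_fun_prod _ fun i hi => ?_
      exact (hYm i).mono (ℱ.mono (by simp at hi; omega)) le_rfl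

lemma fub_aux {Ω : Type*} {m0 : MeasurableSpace Ω} (μ : Measure Ω) [IsProbabilityMeasure μ]
    (V M : Ω → ℝ) (hV : Measurable V) (hM : Integrable M μ) (w : ℝ → ℝ) (b : ℝ) (hb : 0 ≤ b) (hb1 : b ≤ 1)
    (hw : IntervalIntegrable w volume 0 b) (H : Ω → ℝ → ℝ) (hH : Measurable (Function.uncurry H))
    (hHb : ∀ ω x, |H ω x| ≤ 1)
    (h : ∀ x ∈ Set.Icc (0:ℝ) 1, ∫ ω, M ω * (if V ω ≤ x then (1:ℝ) else 0) ∂μ = ∫ ω, M ω * H ω x ∂μ) :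
    Integrable (fun ω => M ω * (∫ x in (0:ℝ)..b, w x * (if V ω ≤ x then (1:ℝ) else 0))) μ ∧
    Integrable (fun ω => M ω * (∫ x in (0:ℝ)..b, w x * H ω x)) μ ∧
    ∫ ω, M ω * (∫ x in (0:ℝ)..b, w x * (if V ω ≤ x then (1:ℝ) else 0)) ∂μ
     = ∫ ω, M ω * (∫ x in (0:ℝ)..b, w x * H ω x) ∂μ := by
  have key : ∀ K : Ω → ℝ → ℝ, Measurable (Function.uncurry K) → (∀ ω x, |K ω x| ≤ 1) →
      Integrable (fun ω => M ω * (∫ x in (0:ℝ)..b, w x * K ω x)) μ ∧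
      ∫ ω, M ω * (∫ x in (0:ℝ)..b, w x * K ω x) ∂μ
       = ∫ x in Set.Ioc 0 b, w x * ∫ ω, M ω * K ω x ∂μ := by
    intro K hK hKb
    have hw' : Integrable w (volume.restrict (Set.Ioc 0 b)) := by
      rwa [intervalIntegrable_iff_integrableOn_Ioc_of_le hb] at hw
    have h1 : Integrable (fun z : Ω × ℝ => M z.1 * w z.2) (μ.prod (volume.restrict (Set.Ioc 0 b))) :=
      hM.mul_prod hw'
    have h2 : Integrable (fun z : Ω × ℝ => K z.1 z.2 * (M z.1 * w z.2)) (μ.prod (volume.restrict (Set.Ioc 0 b))) :=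
      h1.bdd_mul (c := 1) hK.aestronglyMeasurable (Filter.Eventually.of_forall fun z => hKb z.1 z.2)
    have h3 := integral_integral_swap (f := fun ω x => K ω x * (M ω * w x)) h2
    simp only [intervalIntegral.integral_of_le hb, ← integral_const_mul]
    have e1 : ∀ ω, (∫ x in Set.Ioc 0 b, M ω * (w x * K ω x)) = ∫ x in Set.Ioc 0 b, K ω x * (M ω * w x) :=
      fun ω => by congr 1; ext x; ring
    have e2 : ∀ x, (∫ ω, w x * (M ω * K ω x) ∂μ) = ∫ ω, K ω x * (M ω * w x) ∂μ :=
      fun x => by congr 1; ext ω; ring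
    simp only [e1, e2]
    exact ⟨h2.integral_prod_left, h3⟩
  obtain ⟨k1, k2⟩ := key (fun ω x => if V ω ≤ x then (1:ℝ) else 0)
    (Measurable.ite (measurableSet_le (hV.comp measurable_fst) measurable_snd)
      measurable_const measurable_const) (by intro ω x; split_ifs <;> simp)
  obtain ⟨k3, k4⟩ := key H hH hHb
  refine ⟨k1, k3, ?_⟩
  rw [k2, k4]
  refine setIntegral_congr_fun measurableSet_Ioc fun x hx => ?_
  rw [h x ⟨hx.1.le, hx.2.trans hb1⟩]

lemma pull_aux {Ω : Type*} {m m0 : MeasurableSpace Ω} (hm : m ≤ m0) (μ : Measure Ω) [IsProbabilityMeasure μ]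
    (M f g : Ω → ℝ) (hM : Measurable[m] M) (K : ℝ) (hMb : ∀ ω, |M ω| ≤ K) (hf : Integrable f μ)
    (h : μ[f | m] =ᵐ[μ] g) : ∫ ω, M ω * f ω ∂μ = ∫ ω, M ω * g ω ∂μ := by
  have hMf : Integrable (M * f) μ :=
    hf.bdd_mul (c := K) (hM.mono hm le_rfl).aestronglyMeasurable (Filter.Eventually.of_forall hMb)
  have h1 := condExp_mul_of_stronglyMeasurable_left (μ := μ) hM.stronglyMeasurable hMf hf
  calc ∫ ω, M ω * f ω ∂μ = ∫ ω, (μ[M * f | m]) ω ∂μ := (integral_condExp hm).symm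
    _ = _ := by
      refine integral_congr_ae ?_
      filter_upwards [h1, h] with ω h1 h2
      rw [h1, Pi.mul_apply, h2]

noncomputable def wt (A l x : ℝ) : ℝ := A / 2 * ((1-x) * √(1-x))⁻¹ - l^2 * ((1-x)^2)⁻¹

lemma wt_cont (A l b : ℝ) (hb : b < 1) : ContinuousOn (wt A l) (Set.Iic b) := by
  unfold wt
  have h : ∀ x ∈ Set.Iic b, 0 < 1 - x := fun x hx => by have : x ≤ b := hx; linarith
  refine ContinuousOn.sub (continuousOn_const.mul (ContinuousOn.inv₀ (by fun_prop) ?_)) (continuousOn_const.mul (ContinuousOn.inv₀ (by fun_prop) ?_))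
  · intro x hx; have := h x hx; positivity
  · intro x hx; have := h x hx; positivity

lemma wt_int (A l a b : ℝ) (hab : a ≤ b) (hb : b < 1) : IntervalIntegrable (wt A l) volume a b := by
  refine ((wt_cont A l b hb).mono ?_).intervalIntegrable
  rw [Set.uIcc_of_le hab]; exact fun x hx => hx.2

noncomputable def Wt (A l x : ℝ) : ℝ := A * (√(1-x))⁻¹ - l^2 * (1-x)⁻¹

lemma Wt_deriv (A l x : ℝ) (hx : x < 1) : HasDerivAt (Wt A l) (wt A l x) x := by
  have h0 : 0 < 1 - x := by linarith
  have h1 : HasDerivAt (fun x : ℝ => 1 - x) (-1) x := by simpa using (hasDerivAt_id x).const_sub 1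
  have h2 := (h1.sqrt h0.ne').inv (Real.sqrt_pos.2 h0).ne'
  have h3 := h1.inv h0.ne'
  have h4 : HasDerivAt (Wt A l) _ x := (h2.const_mul A).sub (h3.const_mul (l^2))
  refine h4.congr_deriv ?_
  unfold wt
  have := Real.sq_sqrt h0.le
  have hs := Real.sqrt_pos.2 h0
  rw [this]
  field_simp

lemma int_wt (A l a b : ℝ) (hab : a ≤ b) (hb : b < 1) : ∫ x in a..b, wt A l x = Wt A l b - Wt A l a := by
  refine intervalIntegral.integral_eq_sub_of_hasDerivAt ?_ (wt_int A l a b hab hb)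
  intro x hx; rw [Set.uIcc_of_le hab] at hx
  exact Wt_deriv A l x (hx.2.trans_lt hb)

lemma int_xwt (A l b : ℝ) (hb0 : 0 ≤ b) (hb : b < 1) :
    ∫ x in (0:ℝ)..b, wt A l x * x = b * Wt A l b + 2 * A * √(1-b) - l^2 * Real.log (1-b) - 2 * A := by
  have := intervalIntegral.integral_eq_sub_of_hasDerivAt (a := 0) (b := b)
    (f := fun x => x * Wt A l x + 2 * A * √(1-x) - l^2 * Real.log (1-x)) (f' := fun x => wt A l x * x) ?_ ?_
  · rw [this]; simp
  · intro x hx; rw [Set.uIcc_of_le hb0] at hx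
    have h0 : 0 < 1 - x := by linarith [hx.2]
    have h1 : HasDerivAt (fun x : ℝ => 1 - x) (-1) x := by simpa using (hasDerivAt_id x).const_sub 1
    have h2 := (h1.sqrt h0.ne')
    have h3 := h1.log h0.ne'
    have h4 := (hasDerivAt_id x).mul (Wt_deriv A l x (by linarith))
    have h5 : HasDerivAt (fun x => x * Wt A l x + 2 * A * √(1-x) - l^2 * Real.log (1-x)) _ x :=
      (h4.add (h2.const_mul (2*A))).sub (h3.const_mul (l^2))
    refine h5.congr_deriv ?_
    have hs := Real.sqrt_pos.2 h0
    have hq := Real.sq_sqrt h0.le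
    simp only [Wt, id]
    field_simp
    ring
  · refine ContinuousOn.intervalIntegrable ?_
    rw [Set.uIcc_of_le hb0]
    exact ((wt_cont A l b hb).mono fun x hx => hx.2).mul continuousOn_id

lemma int_ind (A l b u : ℝ) (hb0 : 0 ≤ b) (hb : b < 1) (hu0 : 0 ≤ u) :
    ∫ x in (0:ℝ)..b, wt A l x * (if u ≤ x then (1:ℝ) else 0) = if u ≤ b then Wt A l b - Wt A l u else 0 := by
  split_ifs with h
  · have hle : ∫ x in (0:ℝ)..b, wt A l x * (if u ≤ x then (1:ℝ) else 0) = ∫ x in u..b, wt A l x := by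
      rw [intervalIntegral.integral_of_le hb0, intervalIntegral.integral_of_le h]
      rw [← integral_Icc_eq_integral_Ioc, ← integral_Icc_eq_integral_Ioc,
        ← integral_indicator measurableSet_Icc, ← integral_indicator measurableSet_Icc]
      congr 1; ext x
      simp only [Set.indicator, Set.mem_Icc]
      by_cases h1 : u ≤ x
      · simp [h1, hu0.trans h1]
      · simp [h1]
    rw [hle, int_wt A l u b h hb]
  · refine (intervalIntegral.integral_congr (g := fun _ => (0:ℝ)) fun x hx => ?_).trans (by simp)
    rw [Set.uIcc_of_le hb0] at hx
    have : ¬ u ≤ x := fun h' => h (h'.trans hx.2)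
    simp [this]

/-- the constant -/
noncomputable def Cst (l s : ℝ) : ℝ :=
  1 + l * (2 - s) + l^2 * (2-s)^2 - (l + 2 * l^2 * (2 - s)) / s + l^2 / s^2

lemma Cst_bound (ε s l : ℝ) (hs : 0 < s) (hs2 : s^2 = ε) (hs1 : s ≤ 1/2) :
    Cst l s + ∫ x in (0:ℝ)..(1-ε), wt (l + 2 * l^2 * (2 - s)) l x * x ≤ 1 + l^2 * Real.log (1/ε) := by
  have hε : 0 < ε := by rw [← hs2]; positivity
  have hss : √ε = s := by rw [← hs2]; exact Real.sqrt_sq hs.le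
  rw [int_xwt _ _ _ (by nlinarith) (by linarith)]
  simp only [Wt, sub_sub_cancel, hss, Cst, one_div, Real.log_inv]
  rw [← hs2]
  have : 1 + l * (2 - s) + l^2 * (2-s)^2 - (l + 2 * l^2 * (2 - s)) / s + l^2 / s^2 +
     ((1 - s ^ 2) * ((l + 2 * l ^ 2 * (2 - s)) * s⁻¹ - l ^ 2 * (s ^ 2)⁻¹) + 2 * (l + 2 * l ^ 2 * (2 - s)) * s -
          l ^ 2 * Real.log (s ^ 2) - 2 * (l + 2 * l ^ 2 * (2 - s))) = 1 + l^2 * (-Real.log (s^2)) + l^2 * (1 - (2-s)^2) := by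
    field_simp
    ring
  rw [this]
  nlinarith [mul_nonneg (sq_nonneg l) (show 0 ≤ (2-s)^2 - 1 by nlinarith)]

lemma Sstat_eq (ε s u : ℝ) (hs : 0 < s) (hs2 : s^2 = ε) :
    Sstat ε u = (if u ≤ 1 - ε then (√(1-u))⁻¹ else s⁻¹) - (2 - s) := by
  have hε : 0 < ε := by rw [← hs2]; positivity
  have hss : √ε = s := by rw [← hs2]; exact Real.sqrt_sq hs.le
  unfold Sstat
  rw [hss]
  congr 1
  split_ifs with h1 h2 h2
  · refine min_eq_right ?_
    refine inv_anti₀ hs ?_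
    rw [← hss]; exact Real.sqrt_le_sqrt (by linarith)
  · refine min_eq_left ?_
    refine inv_anti₀ (Real.sqrt_pos.2 (by linarith)) ?_
    rw [← hss]; exact Real.sqrt_le_sqrt (by linarith)
  · linarith
  · rfl

lemma Sstat_bd (ε s u : ℝ) (hs : 0 < s) (hs2 : s^2 = ε) (hs1 : s ≤ 1/2) (hu0 : 0 ≤ u) :
    -1 ≤ Sstat ε u ∧ Sstat ε u ≤ s⁻¹ := by
  have hε : 0 < ε := by rw [← hs2]; positivity
  have hss : √ε = s := by rw [← hs2]; exact Real.sqrt_sq hs.le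
  rw [Sstat_eq ε s u hs hs2]
  have h2 : (2:ℝ) ≤ s⁻¹ := by
    rw [le_inv_comm₀ (by norm_num) hs]; linarith
  split_ifs with h
  · have h3 : s ≤ √(1-u) := by rw [← hss]; exact Real.sqrt_le_sqrt (by linarith)
    have h4 : √(1-u) ≤ 1 := by rw [Real.sqrt_le_left (by norm_num)]; linarith
    have h5 : 1 ≤ (√(1-u))⁻¹ := (one_le_inv₀ (by linarith)).2 h4
    have h6 : (√(1-u))⁻¹ ≤ s⁻¹ := inv_anti₀ hs h3
    constructor <;> linarith
  · constructor <;> linarith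

lemma exp_bound_aux (ε s l u : ℝ) (hs : 0 < s) (hs2 : s^2 = ε) (hs1 : s ≤ 1/2) (hu0 : 0 ≤ u) 
    (hl : 0 < l) (hls : l ≤ s / 4) :
    Real.exp (-l * Sstat ε u) ≤ Cst l s + ∫ x in (0:ℝ)..(1-ε),
      wt (l + 2 * l^2 * (2 - s)) l x * (if u ≤ x then (1:ℝ) else 0) := by
  have hε : 0 < ε := by rw [← hs2]; positivity
  have hss : √ε = s := by rw [← hs2]; exact Real.sqrt_sq hs.le
  obtain ⟨b1, b2⟩ := Sstat_bd ε s u hs hs2 hs1 hu0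
  have hls' : l * s⁻¹ ≤ 1/4 := by
    rw [← div_eq_mul_inv, div_le_iff₀ hs]; linarith
  have h1 : |(-l * Sstat ε u)| ≤ 1 := by
    rw [abs_le]; constructor
    · nlinarith [mul_le_mul_of_nonneg_left b2 hl.le]
    · nlinarith
  have h2 := (abs_le.1 (Real.abs_exp_sub_one_sub_id_le h1)).2
  have h3 : Real.exp (-l * Sstat ε u) ≤ 1 + (-l * Sstat ε u) + (-l * Sstat ε u)^2 := by linarith
  refine h3.trans (le_of_eq ?_)
  rw [int_ind _ _ _ _ (by nlinarith) (by linarith) hu0, Sstat_eq ε s u hs hs2]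
  split_ifs with h
  · have h0 : 0 < 1 - u := by linarith
    have hq := Real.sq_sqrt h0.le
    have hp := Real.sqrt_pos.2 h0
    simp only [Wt, Cst, sub_sub_cancel, hss]
    rw [← hs2]
    set T := √(1-u)
    rw [← hq]
    field_simp
    ring
  · simp only [Cst]
    field_simp
    ring
noncomputable def gg (ε p : ℝ) : ℝ := if p ≤ ε then p * (1 - p) / √ε else √(p * (1 - p))

lemma Geps_eq {d : ℕ} (ε : ℝ) (p : Fin d → ℝ) : Geps ε p = ∑ a, gg ε (p a) := by
  unfold Geps Gq peps pepsC
  rw [Finset.sum_div, ← Finset.sum_add_distrib]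
  refine Finset.sum_congr rfl fun a _ => ?_
  unfold gg
  split_ifs with h1 h2 h2
  · linarith
  · simp
  · simp [Real.sqrt_eq_rpow]
  · linarith

lemma wt_lb (s l x : ℝ) (hs : 0 < s) (hs1 : s ≤ 1/2) (hl : 0 < l) (hls : l ≤ s/4) (hx : x ≤ 1 - s^2) :
    l / 4 * ((1-x) * √(1-x))⁻¹ ≤ wt (l + 2 * l^2 * (2 - s)) l x := by
  have h0 : 0 < 1 - x := by nlinarith
  have hq := Real.sq_sqrt h0.le
  have hp := Real.sqrt_pos.2 h0
  have hsT : s ≤ √(1-x) := Real.le_sqrt_of_sq_le (by linarith)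
  unfold wt
  set T := √(1-x)
  rw [← hq]
  have e : (l + 2 * l ^ 2 * (2 - s)) / 2 * (T ^ 2 * T)⁻¹ - l ^ 2 * ((T ^ 2) ^ 2)⁻¹ - l / 4 * (T ^ 2 * T)⁻¹
     = (T ^ 2 * T)⁻¹ * (l / 4 + l^2 * (2 - s) - l^2 / T) := by field_simp; ring
  have h3 : l^2 / T ≤ l / 4 := by rw [div_le_iff₀ hp]; nlinarith
  have h4 : 0 ≤ l^2 * (2 - s) := by have : 0 ≤ 2 - s := by linarith
                                    positivity
  have h5 : 0 ≤ (T ^ 2 * T)⁻¹ * (l / 4 + l^2 * (2 - s) - l^2 / T) := mul_nonneg (by positivity) (by linarith)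
  linarith

lemma rpow_le_self_aux (x p : ℝ) (hx0 : 0 ≤ x) (hx1 : x ≤ 1) (hp : 0 < p) (hp1 : p ≤ 1) :
    x ^ (1/p) ≤ x := by
  have h : 1 ≤ 1/p := by rw [le_div_iff₀ hp]; linarith
  calc x ^ (1/p) ≤ x ^ (1:ℝ) := Real.rpow_le_rpow_of_exponent_ge' hx0 hx1 (by norm_num) h
    _ = x := Real.rpow_one x

lemma pow_aux (x p m : ℝ) (hx0 : 1/4 ≤ x) (hp : 0 < p) (hpm : p ≤ m) (hm : m ≤ 1/2) (hx : x ≤ 1 - m) :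
    1/12 ≤ x - x ^ (1/p) := by
  have hm0 : 0 < m := by linarith
  have hx00 : 0 < x := by linarith
  have h1 : 1 + 1/(2*m) ≤ 1/p := by
    have : 1/m ≤ 1/p := one_div_le_one_div_of_le hp hpm
    have h2 : 1/m - 1/(2*m) = 1/(2*m) := by field_simp; ring
    have h3 : 1 ≤ 1/(2*m) := by rw [le_div_iff₀ (by positivity)]; linarith
    linarith
  have h2 : x ^ (1/p) ≤ x * x ^ (1/(2*m)) := by
    calc x ^ (1/p) ≤ x ^ (1 + 1/(2*m)) := Real.rpow_le_rpow_of_exponent_ge hx00 (by linarith) h1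
      _ = _ := by rw [Real.rpow_add hx00, Real.rpow_one]
  have h3 : x ^ (1/(2*m)) ≤ 2/3 := by
    have h4 : x ≤ Real.exp (-m) := by linarith [Real.add_one_le_exp (-m)]
    have h5 : x ^ (1/(2*m)) ≤ Real.exp (-m) ^ (1/(2*m)) := Real.rpow_le_rpow hx00.le h4 (by positivity)
    rw [← Real.exp_mul] at h5
    have h6 : -m * (1/(2*m)) = -(1/2) := by field_simp
    rw [h6, Real.exp_neg] at h5
    have h7 : (3/2:ℝ) ≤ Real.exp (1/2) := by linarith [Real.add_one_le_exp (1/2)]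
    have h8 := inv_anti₀ (by norm_num) h7
    refine h5.trans (h8.trans (by norm_num))
  nlinarith

lemma cont_aux (p : ℝ) (hp : 0 < p) : Continuous fun x : ℝ => x ^ (1/p) :=
  Real.continuous_rpow_const (by positivity)

lemma Ipos (s l p : ℝ) (hs : 0 < s) (hs1 : s ≤ 1/2) (hl : 0 < l) (hls : l ≤ s/4) (hp : 0 < p) (hp1 : p ≤ 1)
    (x : ℝ) (hx0 : 0 ≤ x) (hx : x ≤ 1 - s^2) :
    0 ≤ wt (l + 2 * l^2 * (2 - s)) l x * (x - x ^ (1/p)) := by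
  refine mul_nonneg (le_trans ?_ (wt_lb s l x hs hs1 hl hls hx)) ?_
  · have : 0 < 1 - x := by nlinarith
    positivity
  · linarith [rpow_le_self_aux x p hx0 (by nlinarith) hp hp1]

lemma I_int (s l p b c : ℝ) (hp : 0 < p) (hbc : b ≤ c) (hc : c < 1) :
    IntervalIntegrable (fun x => wt (l + 2 * l^2 * (2 - s)) l x * (x - x ^ (1/p))) volume b c := by
  refine ContinuousOn.intervalIntegrable ?_
  rw [Set.uIcc_of_le hbc]
  exact ((wt_cont _ l c hc).mono fun x hx => hx.2).mul (continuous_id.sub (cont_aux p hp)).continuousOn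

lemma I_nonneg (s l p : ℝ) (hs : 0 < s) (hs1 : s ≤ 1/2) (hl : 0 < l) (hls : l ≤ s/4) (hp : 0 < p) (hp1 : p ≤ 1) :
    0 ≤ ∫ x in (0:ℝ)..(1-s^2), wt (l + 2 * l^2 * (2 - s)) l x * (x - x ^ (1/p)) :=
  intervalIntegral.integral_nonneg (by nlinarith) fun x hx => Ipos s l p hs hs1 hl hls hp hp1 x hx.1 hx.2

lemma I_lb (s l p m : ℝ) (hs : 0 < s) (hs1 : s ≤ 1/2) (hl : 0 < l) (hls : l ≤ s/4) (hp : 0 < p)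
    (hpm : p ≤ m) (hsm : s^2 ≤ m) (hm : m ≤ 1/2) :
    l / 240 / √m ≤ ∫ x in (0:ℝ)..(1-s^2), wt (l + 2 * l^2 * (2 - s)) l x * (x - x ^ (1/p)) := by
  have hm0 : 0 < m := by linarith
  have hsub : (∫ x in (1 - 3/2*m)..(1-m), wt (l + 2 * l^2 * (2 - s)) l x * (x - x ^ (1/p))) ≤ 
     ∫ x in (0:ℝ)..(1-s^2), wt (l + 2 * l^2 * (2 - s)) l x * (x - x ^ (1/p)) := by
    refine intervalIntegral.integral_mono_interval (by linarith) (by linarith) (by linarith) ?_ (I_int s l p _ _ hp (by nlinarith) (by nlinarith))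
    refine (ae_restrict_iff' measurableSet_Ioc).2 (Filter.Eventually.of_forall fun x hx => ?_)
    exact Ipos s l p hs hs1 hl hls hp (by linarith) x hx.1.le hx.2
  refine le_trans ?_ hsub
  have hc : (∫ x in (1 - 3/2*m)..(1-m), l / 4 * (15/8 * (m * √m))⁻¹ * (1/12)) ≤
      ∫ x in (1 - 3/2*m)..(1-m), wt (l + 2 * l^2 * (2 - s)) l x * (x - x ^ (1/p)) := by
    refine intervalIntegral.integral_mono_on (by linarith) (by simp) (I_int s l p _ _ hp (by linarith) (by linarith)) ?_
    intro x hx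
    have h0 : 0 < 1 - x := by linarith [hx.2]
    refine mul_le_mul (le_trans ?_ (wt_lb s l x hs hs1 hl hls (by linarith [hx.2]))) (pow_aux x p m (by linarith [hx.1]) hp hpm hm hx.2) (by norm_num) ?_
    · refine mul_le_mul_of_nonneg_left (inv_anti₀ (by positivity) ?_) (by positivity)
      have h1 : √(1-x) ≤ 5/4 * √m := by
        rw [Real.sqrt_le_left (by positivity), mul_pow, Real.sq_sqrt hm0.le]
        linarith [hx.1]
      calc (1-x) * √(1-x) ≤ (3/2*m) * (5/4 * √m) := mul_le_mul (by linarith [hx.1]) h1 (by positivity) (by positivity)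
        _ = _ := by ring
    · exact le_trans (by positivity) (wt_lb s l x hs hs1 hl hls (by linarith [hx.2]))
  refine le_trans ?_ hc
  rw [intervalIntegral.integral_const, smul_eq_mul]
  have hr := Real.sqrt_pos.2 hm0
  have e : (1 - m - (1 - 3/2*m)) * (l / 4 * (15/8 * (m * √m))⁻¹ * (1/12)) = l / 180 / √m := by
    field_simp; ring
  rw [e]
  gcongr
  norm_num

lemma gg_le (ε s p m : ℝ) (hs : 0 < s) (hs2 : s^2 = ε) (hp : 0 < p) (hp1 : p ≤ 1) (hm : m = max p ε) :
    gg ε p ≤ p / √m := by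
  have hss : √ε = s := by rw [← hs2]; exact Real.sqrt_sq hs.le
  unfold gg
  split_ifs with h
  · rw [hm, max_eq_right h, hss]
    gcongr
    nlinarith
  · rw [hm, max_eq_left (by linarith), Real.div_sqrt]
    exact Real.sqrt_le_sqrt (by nlinarith)

lemma G_bound {d : ℕ} (ε s l : ℝ) (hs : 0 < s) (hs2 : s^2 = ε) (hs1 : s ≤ 1/2) (hl : 0 < l) (hls : l ≤ s/4)
    (p : Fin d → ℝ) (hp : ∀ a, 0 < p a) (hsum : ∑ a, p a = 1) :
    l / 480 * (Geps ε p - s) ≤ ∑ a, p a * ∫ x in (0:ℝ)..(1-ε), wt (l + 2 * l^2 * (2 - s)) l x * (x - x ^ (1/p a)) := by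
  have hss : √ε = s := by rw [← hs2]; exact Real.sqrt_sq hs.le
  have hε0 : 0 < ε := by rw [← hs2]; positivity
  have hε : ε ≤ 1/4 := by nlinarith
  have hple : ∀ a, p a ≤ 1 := fun a => by
    rw [← hsum]; exact Finset.single_le_sum (f := p) (fun i _ => (hp i).le) (Finset.mem_univ a)
  set J : ℝ → ℝ := fun q => ∫ x in (0:ℝ)..(1-ε), wt (l + 2 * l^2 * (2 - s)) l x * (x - x ^ (1/q)) with hJ
  have hJ0 : ∀ a, 0 ≤ J (p a) := fun a => by
    have := I_nonneg s l (p a) hs hs1 hl hls (hp a) (hple a)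
    rw [hs2] at this; exact this
  have hJ1 : ∀ a m, p a ≤ m → ε ≤ m → m ≤ 1/2 → l/240 * (p a / √m) ≤ p a * J (p a) := fun a m h1 h2 h3 => by
    have := I_lb s l (p a) m hs hs1 hl hls (hp a) h1 (by linarith) h3
    rw [hs2] at this
    calc _ = p a * (l / 240 / √m) := by ring
      _ ≤ _ := mul_le_mul_of_nonneg_left this (hp a).le
  have hg : ∀ a, p a ≤ 1/2 → l/240 * gg ε (p a) ≤ p a * J (p a) := fun a h => by
    refine le_trans ?_ (hJ1 a (max (p a) ε) (le_max_left _ _) (le_max_right _ _) (max_le h (by linarith)))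
    exact mul_le_mul_of_nonneg_left (gg_le ε s (p a) _ hs hs2 (hp a) (hple a) rfl) (by positivity)
  change _ ≤ ∑ a, p a * J (p a)
  rw [Geps_eq]
  have hgn : ∀ a, 0 ≤ p a * J (p a) := fun a => mul_nonneg (hp a).le (hJ0 a)
  by_cases hall : ∀ a, p a ≤ 1/2
  · have h1 : l/240 * ∑ a, gg ε (p a) ≤ ∑ a, p a * J (p a) := by
      rw [Finset.mul_sum]; exact Finset.sum_le_sum fun a _ => hg a (hall a)
    have h2 : 0 ≤ ∑ a, p a * J (p a) := Finset.sum_nonneg fun a _ => hgn a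
    have h3 : 0 < l * s := by positivity
    linarith
  · push Not at hall
    obtain ⟨b, hb⟩ := hall
    have hsplit : ∀ f : Fin d → ℝ, ∑ a, f a = f b + ∑ a ∈ Finset.univ.erase b, f a := fun f =>
      (Finset.add_sum_erase _ f (Finset.mem_univ b)).symm
    set η := ∑ a ∈ Finset.univ.erase b, p a with hη
    have hpb : p b = 1 - η := by have := hsplit p; linarith
    have hη2 : η < 1/2 := by linarith
    have hη0 : 0 ≤ η := Finset.sum_nonneg fun a _ => (hp a).le
    have hpη : ∀ a ∈ Finset.univ.erase b, p a ≤ η := fun a ha =>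
      Finset.single_le_sum (f := p) (fun i _ => (hp i).le) ha
    set R := ∑ a ∈ Finset.univ.erase b, p a * J (p a) with hR
    have hA : l/240 * ∑ a ∈ Finset.univ.erase b, gg ε (p a) ≤ R := by
      rw [Finset.mul_sum]; exact Finset.sum_le_sum fun a ha => hg a (by linarith [hpη a ha])
    have hR0 : 0 ≤ R := Finset.sum_nonneg fun a _ => hgn a
    have hB : l/240 * √η ≤ R + l/240 * s := by
      by_cases hc : ε ≤ η
      · have : l/240 * (η / √η) ≤ R := by
          rw [hη, Finset.sum_div, Finset.mul_sum, ← hη]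
          exact Finset.sum_le_sum fun a ha => hJ1 a η (hpη a ha) hc hη2.le
        rw [Real.div_sqrt] at this
        have h3 : 0 < l * s := by positivity
        linarith
      · have : √η ≤ s := by rw [← hss]; exact Real.sqrt_le_sqrt (by linarith)
        have := mul_le_mul_of_nonneg_left this (show 0 ≤ l/240 by positivity)
        linarith
    have hC : gg ε (p b) ≤ √η := by
      unfold gg
      rw [if_neg (by linarith)]
      exact Real.sqrt_le_sqrt (by rw [hpb]; nlinarith)
    have hD := mul_le_mul_of_nonneg_left hC (show 0 ≤ l/240 by positivity)
    rw [hsplit (fun a => gg ε (p a)), hsplit (fun a => p a * J (p a))]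
    have := hgn b
    rw [← hR]
    nlinarith

lemma gg_nonneg (ε p : ℝ) (hp : 0 ≤ p) (hp1 : p ≤ 1) : 0 ≤ gg ε p := by
  unfold gg
  have : 0 ≤ 1 - p := by linarith
  split_ifs <;> positivity

lemma Geps_bd {d : ℕ} (ε s : ℝ) (hs : 0 < s) (hs2 : s^2 = ε)
    (p : Fin d → ℝ) (hp : ∀ a, 0 < p a) (hsum : ∑ a, p a = 1) :
    0 ≤ Geps ε p ∧ Geps ε p ≤ s⁻¹ := by
  have hss : √ε = s := by rw [← hs2]; exact Real.sqrt_sq hs.le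
  have hple : ∀ a, p a ≤ 1 := fun a => by
    rw [← hsum]; exact Finset.single_le_sum (f := p) (fun i _ => (hp i).le) (Finset.mem_univ a)
  rw [Geps_eq]
  refine ⟨Finset.sum_nonneg fun a _ => gg_nonneg _ _ (hp a).le (hple a), ?_⟩
  calc ∑ a, gg ε (p a) ≤ ∑ a, p a / s := Finset.sum_le_sum fun a _ => by
        refine (gg_le ε s (p a) _ hs hs2 (hp a) (hple a) rfl).trans ?_
        refine div_le_div_of_nonneg_left (hp a).le hs ?_
        rw [← hss]; exact Real.sqrt_le_sqrt (le_max_right _ _)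
    _ = s⁻¹ := by rw [← Finset.sum_div, hsum, one_div]

lemma Geps_meas {d : ℕ} (ε : ℝ) : Measurable (fun p : Fin d → ℝ => Geps ε p) := by
  simp only [Geps_eq]
  refine Finset.measurable_fun_sum _ fun a _ => ?_
  unfold gg
  refine Measurable.ite (measurableSet_le (measurable_pi_apply a) measurable_const) ?_ ?_
  · fun_prop
  · fun_prop

lemma Sstat_meas (ε s : ℝ) (hs : 0 < s) (hs2 : s^2 = ε) : Measurable (Sstat ε) := by
  have : Sstat ε = fun u => (if u ≤ 1 - ε then (√(1-u))⁻¹ else s⁻¹) - (2 - s) := by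
    ext u; exact Sstat_eq ε s u hs hs2
  rw [this]
  refine Measurable.sub_const (Measurable.ite (measurableSet_le measurable_id measurable_const) ?_ measurable_const) _
  fun_prop

/-- conditional mgf bound, at a fixed probability vector -/
lemma mgf_vec {d : ℕ} (ε s l : ℝ) (hs : 0 < s) (hs2 : s^2 = ε) (hs1 : s ≤ 1/2) (hl : 0 < l) (hls : l ≤ s/4)
    (p : Fin d → ℝ) (hp : ∀ a, 0 < p a) (hsum : ∑ a, p a = 1) :
    Cst l s + ∫ x in (0:ℝ)..(1-ε), wt (l + 2 * l^2 * (2 - s)) l x *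
        ∑ a, p a * (max 0 (min x 1)) ^ (1 / p a)
      ≤ Real.exp (l^2 * Real.log (1/ε) - l / 480 * (Geps ε p - s)) := by
  have hε0 : 0 < ε := by rw [← hs2]; positivity
  have hε : ε ≤ 1/4 := by nlinarith
  have h1 := Cst_bound ε s l hs hs2 hs1
  have h2 := G_bound ε s l hs hs2 hs1 hl hls p hp hsum
  set A := l + 2 * l^2 * (2 - s)
  have hI : ∀ a, IntervalIntegrable (fun x => p a * (wt A l x * (x - x ^ (1/p a)))) volume 0 (1-ε) :=
    fun a => (I_int s l (p a) 0 (1-ε) (hp a) (by linarith) (by linarith)).const_mul _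
  have hx : IntervalIntegrable (fun x => wt A l x * x) volume 0 (1-ε) := by
    refine ContinuousOn.intervalIntegrable ?_
    rw [Set.uIcc_of_le (by linarith)]
    exact ((wt_cont A l (1-ε) (by linarith)).mono fun x hx => hx.2).mul continuousOn_id
  have e : ∫ x in (0:ℝ)..(1-ε), wt A l x * ∑ a, p a * (max 0 (min x 1)) ^ (1 / p a)
      = (∫ x in (0:ℝ)..(1-ε), wt A l x * x)
        - ∑ a, p a * ∫ x in (0:ℝ)..(1-ε), wt A l x * (x - x ^ (1/p a)) := by
    simp only [← intervalIntegral.integral_const_mul]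
    rw [← intervalIntegral.integral_finsetSum (fun a _ => hI a), ← intervalIntegral.integral_sub hx]
    · refine intervalIntegral.integral_congr fun x hx => ?_
      rw [Set.uIcc_of_le (by linarith)] at hx
      have hc : max 0 (min x 1) = x := by
        rw [min_eq_left (by linarith [hx.2]), max_eq_right hx.1]
      simp only [hc]
      have : ∑ a, p a * (wt A l x * (x - x ^ (1/p a)))
          = wt A l x * (x * ∑ a, p a) - wt A l x * ∑ a, p a * x ^ (1/p a) := by
        simp only [Finset.mul_sum, ← Finset.sum_sub_distrib]
        exact Finset.sum_congr rfl fun a _ => by ring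
      rw [this, hsum]; ring
    · have := IntervalIntegrable.sum Finset.univ fun a (_ : a ∈ Finset.univ) => hI a
      have e : (∑ i, fun x => p i * (wt A l x * (x - x ^ (1 / p i)))) = fun x => ∑ i, p i * (wt A l x * (x - x ^ (1 / p i))) := by
        ext x; simp
      rwa [e] at this
  rw [e]
  have h3 := Real.add_one_le_exp (l^2 * Real.log (1/ε) - l / 480 * (Geps ε p - s))
  linarith

lemma step_aux {d : ℕ} {Ω : Type*} {m m0 : MeasurableSpace Ω} (hm : m ≤ m0) (μ : Measure Ω)
    [IsProbabilityMeasure μ] (ε s l : ℝ) (hs : 0 < s) (hs2 : s^2 = ε) (hs1 : s ≤ 1/2)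
    (hl : 0 < l) (hls : l ≤ s/4)
    (P : Ω → Fin d → ℝ) (hP_meas : Measurable[m] P)
    (hP_pos : ∀ ω a, 0 < P ω a) (hP_sum : ∀ ω, ∑ a, P ω a = 1)
    (V : Ω → ℝ) (hV_meas : Measurable V) (hV_range : ∀ ω, V ω ∈ Set.Icc (0:ℝ) 1)
    (hV_cdf : ∀ x ∈ Set.Icc (0:ℝ) 1,
      (μ[(fun ω => if V ω ≤ x then (1:ℝ) else 0) | m])
        =ᵐ[μ] fun ω => ∑ a, P ω a * x ^ (1 / P ω a))
    (M : Ω → ℝ) (K : ℝ) (hM0 : ∀ ω, 0 ≤ M ω) (hMK : ∀ ω, M ω ≤ K) (hM : Measurable[m] M) :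
    ∫ ω, M ω * Real.exp (-l * Sstat ε (V ω)) ∂μ ≤
      ∫ ω, M ω * Real.exp (l^2 * Real.log (1/ε) - l / 480 * (Geps ε (P ω) - s)) ∂μ := by
  have hε0 : 0 < ε := by rw [← hs2]; positivity
  have hε : ε ≤ 1/4 := by nlinarith
  have hMabs : ∀ ω, |M ω| ≤ K := fun ω => by rw [abs_of_nonneg (hM0 ω)]; exact hMK ω
  have hMm : Measurable M := hM.mono hm le_rfl
  have hPm : Measurable P := hP_meas.mono hm le_rfl
  have hMi : Integrable M μ :=
    Integrable.of_bound hMm.aestronglyMeasurable K (Filter.Eventually.of_forall hMabs)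
  have hPle : ∀ ω a, P ω a ≤ 1 := fun ω a => by
    rw [← hP_sum ω]
    exact Finset.single_le_sum (f := P ω) (fun i _ => (hP_pos ω i).le) (Finset.mem_univ a)
  obtain ⟨i1, i2, i3⟩ := fub_aux μ V M hV_meas hMi (wt (l + 2 * l^2 * (2 - s)) l) (1-ε) (by linarith)
    (by linarith) (wt_int _ l 0 (1-ε) (by linarith) (by linarith))
    (fun ω x => ∑ a, P ω a * (max 0 (min x 1)) ^ (1 / P ω a))
    (by
      refine Finset.measurable_fun_sum _ fun a _ => ?_
      have hPa : Measurable fun z : Ω × ℝ => P z.1 a :=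
        (measurable_pi_apply a).comp (hPm.comp measurable_fst)
      have hx : Measurable fun z : Ω × ℝ => max 0 (min z.2 1) := by fun_prop
      exact hPa.mul (hx.pow (measurable_const.div hPa)))
    (by
      intro ω x
      have h0 : 0 ≤ max 0 (min x 1) := le_max_left _ _
      have h1 : max 0 (min x 1) ≤ 1 := max_le zero_le_one (min_le_right _ _)
      rw [abs_of_nonneg (Finset.sum_nonneg fun a _ =>
        mul_nonneg (hP_pos ω a).le (Real.rpow_nonneg h0 _))]
      refine le_trans (Finset.sum_le_sum fun a _ => ?_) (hP_sum ω).le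
      exact mul_le_of_le_one_right (hP_pos ω a).le
        (Real.rpow_le_one h0 h1 (by have := hP_pos ω a; positivity)))
    (by
      intro x hx
      have hc : max 0 (min x 1) = x := by
        rw [min_eq_left hx.2, max_eq_right hx.1]
      simp only [hc]
      refine pull_aux hm μ M _ _ hM K hMabs ?_ (hV_cdf x hx)
      refine Integrable.of_bound (Measurable.aestronglyMeasurable ?_) 1 (Filter.Eventually.of_forall ?_)
      · exact Measurable.ite (measurableSet_le hV_meas measurable_const) measurable_const measurable_const
      · intro ω; split_ifs <;> simp)
  have hMC : Integrable (fun ω => M ω * Cst l s) μ := hMi.mul_const _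
  have hL : 0 ≤ l^2 * Real.log (1/ε) := by
    refine mul_nonneg (by positivity) (Real.log_nonneg ?_)
    rw [le_div_iff₀ hε0]; linarith
  calc ∫ ω, M ω * Real.exp (-l * Sstat ε (V ω)) ∂μ
      ≤ ∫ ω, (M ω * Cst l s + M ω * (∫ x in (0:ℝ)..(1-ε), wt (l + 2 * l^2 * (2 - s)) l x *
          (if V ω ≤ x then (1:ℝ) else 0))) ∂μ := by
        refine integral_mono_of_nonneg (Filter.Eventually.of_forall fun ω =>
          mul_nonneg (hM0 ω) (Real.exp_pos _).le) (hMC.add i1) (Filter.Eventually.of_forall fun ω => ?_)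
        simp only [← mul_add]
        exact mul_le_mul_of_nonneg_left
          (exp_bound_aux ε s l (V ω) hs hs2 hs1 (hV_range ω).1 hl hls) (hM0 ω)
    _ = ∫ ω, (M ω * Cst l s + M ω * (∫ x in (0:ℝ)..(1-ε), wt (l + 2 * l^2 * (2 - s)) l x *
          ∑ a, P ω a * (max 0 (min x 1)) ^ (1 / P ω a))) ∂μ := by
        rw [integral_add hMC i1, integral_add hMC i2, i3]
    _ ≤ _ := by
        refine integral_mono (hMC.add i2) ?_ fun ω => ?_
        · refine hMi.mul_bdd (c := Real.exp (l^2 * Real.log (1/ε) + l / 480 * s)) ?_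
            (Filter.Eventually.of_forall fun ω => ?_)
          · have := (Geps_meas (d := d) ε).comp hPm
            have h2 : Measurable fun ω => Geps ε (P ω) := this
            exact Measurable.aestronglyMeasurable (by fun_prop)
          · rw [Real.norm_eq_abs, Real.abs_exp]
            refine Real.exp_le_exp.2 ?_
            have := mul_nonneg (show 0 ≤ l/480 by positivity)
              (Geps_bd ε s hs hs2 (P ω) (hP_pos ω) (hP_sum ω)).1
            linarith
        · simp only [← mul_add]
          exact mul_le_mul_of_nonneg_left
            (mgf_vec ε s l hs hs2 hs1 hl hls (P ω) (hP_pos ω) (hP_sum ω)) (hM0 ω)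

/-- Under the alternative hypothesis (each `V_t` has conditional CDF
`x ↦ ∑_a P_t(a) x^{1/P_t(a)}` given the past), with `ε = log(1/δ)/n ≤ 1/4` and
`τ = √(2 n log(1/ε) log(1/δ)) + (3/2) log(1/δ)/√ε`, with probability at least
`1 − 2δ` one has `∑_t S_ε(V_t) ≥ (1/480) ∑_t G_ε(P_t) − 3τ`. -/
theorem alternative_lower_bound {d n : ℕ} (hd : 0 < d) (hn : 1 ≤ n)
    (δ ε : ℝ) (hδ : δ ∈ Set.Ioo (0:ℝ) 1)
    (hεdef : ε = Real.log (1/δ) / n) (hε : ε ≤ 1/4)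
    {Ω : Type*} {m0 : MeasurableSpace Ω} (μ : Measure Ω) [IsProbabilityMeasure μ]
    (ℱ : Filtration ℕ m0)
    (P : Fin n → Ω → Fin d → ℝ)
    (hP_meas : ∀ t : Fin n, Measurable[ℱ t.val] (P t))
    (hP_pos : ∀ t ω a, 0 < P t ω a) (hP_sum : ∀ t ω, ∑ a, P t ω a = 1)
    (V : Fin n → Ω → ℝ)
    (hV_meas : ∀ t : Fin n, Measurable[ℱ (t.val + 1)] (V t))
    (hV_range : ∀ t ω, V t ω ∈ Set.Icc (0:ℝ) 1)
    (hV_cdf : ∀ t : Fin n, ∀ x ∈ Set.Icc (0:ℝ) 1,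
      (μ[(fun ω => if V t ω ≤ x then (1:ℝ) else 0) | ℱ t.val])
        =ᵐ[μ] fun ω => ∑ a, P t ω a * x ^ (1 / P t ω a)) :
    ENNReal.ofReal (1 - 2 * δ) ≤
      μ {ω | (1/480) * ∑ t, Geps ε (P t ω)
              - 3 * (Real.sqrt (2 * n * Real.log (1/ε) * Real.log (1/δ))
                      + (3/2) * Real.log (1/δ) / Real.sqrt ε)
            ≤ ∑ t, Sstat ε (V t ω)} := by
  have hδ0 := hδ.1
  have hδ1 := hδ.2
  have hn0 : (0:ℝ) < n := by exact_mod_cast hn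
  have hℓ : Real.log (1/δ) = n * ε := by rw [hεdef]; field_simp
  have hℓ0 : 0 < Real.log (1/δ) := Real.log_pos (by rw [lt_div_iff₀ hδ0]; linarith)
  have hε0 : 0 < ε := by rw [hεdef]; positivity
  obtain ⟨s, hs, hs2⟩ : ∃ s : ℝ, 0 < s ∧ s^2 = ε := ⟨√ε, Real.sqrt_pos.2 hε0, Real.sq_sqrt hε0.le⟩
  have hss : √ε = s := by rw [← hs2]; exact Real.sqrt_sq hs.le
  have hs1 : s ≤ 1/2 := by nlinarith
  have hL0 : 0 ≤ Real.log (1/ε) := Real.log_nonneg (by rw [le_div_iff₀ hε0]; linarith)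
  rw [hℓ, hss]
  obtain ⟨r, hr, hr2⟩ : ∃ r : ℝ, 0 ≤ r ∧ r^2 = Real.log (1/ε) :=
    ⟨_, Real.sqrt_nonneg _, Real.sq_sqrt hL0⟩
  obtain ⟨l, hldef⟩ : ∃ l : ℝ, l = s / (4 + r) := ⟨_, rfl⟩
  have hl : 0 < l := by rw [hldef]; positivity
  have hls : l ≤ s / 4 := by
    rw [hldef]; exact div_le_div_of_nonneg_left hs.le (by norm_num) (by linarith)
  have hlr : l * (4 + r) = s := by rw [hldef]; field_simp
  -- the exponential supermartingale
  obtain ⟨Y, hY⟩ : ∃ Y : ℕ → Ω → ℝ, Y = fun k ω => if h : k < n then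
      Real.exp (-l * Sstat ε (V ⟨k, h⟩ ω)) *
      Real.exp (-(l^2 * Real.log (1/ε) - l / 480 * (Geps ε (P ⟨k, h⟩ ω) - s))) else 1 := ⟨_, rfl⟩
  have hE : ∀ t ω, Real.exp (-(l^2 * Real.log (1/ε) - l / 480 * (Geps ε (P t ω) - s)))
      ≤ Real.exp (l / 480 * s⁻¹) := fun t ω => by
    refine Real.exp_le_exp.2 ?_
    have h1 := mul_le_mul_of_nonneg_left (Geps_bd ε s hs hs2 (P t ω) (hP_pos t ω) (hP_sum t ω)).2
      (show 0 ≤ l/480 by positivity)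
    have h2 : 0 ≤ l^2 * Real.log (1/ε) := by positivity
    have h3 : 0 ≤ l * s := by positivity
    linarith
  have hSE : ∀ t ω, Real.exp (-l * Sstat ε (V t ω)) ≤ Real.exp l := fun t ω => by
    refine Real.exp_le_exp.2 ?_
    have := (Sstat_bd ε s (V t ω) hs hs2 hs1 (hV_range t ω).1).1
    nlinarith
  have hGm : ∀ t : Fin n, Measurable[ℱ t.val] fun ω => Geps ε (P t ω) := fun t =>
    (Geps_meas (d := d) ε).comp (hP_meas t)
  have hEm : ∀ t : Fin n, Measurable[ℱ t.val] fun ω =>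
      Real.exp (-(l^2 * Real.log (1/ε) - l / 480 * (Geps ε (P t ω) - s))) := fun t =>
    Real.measurable_exp.comp
      (Measurable.neg (Measurable.const_sub (((hGm t).sub_const s).const_mul (l/480)) _))
  have hSm : ∀ t : Fin n, Measurable[ℱ (t.val+1)] fun ω => Real.exp (-l * Sstat ε (V t ω)) := fun t =>
    Real.measurable_exp.comp (((Sstat_meas ε s hs hs2).comp (hV_meas t)).const_mul (-l))
  have hY0 : ∀ k ω, 0 ≤ Y k ω := by
    intro k ω; rw [hY]; dsimp only; split_ifs <;> positivity
  have hYB : ∀ k ω, Y k ω ≤ Real.exp l * Real.exp (l / 480 * s⁻¹) := by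
    intro k ω; rw [hY]; dsimp only; split_ifs with h
    · exact mul_le_mul (hSE _ ω) (hE _ ω) (Real.exp_pos _).le (Real.exp_pos _).le
    · rw [← Real.exp_add]; exact Real.one_le_exp (by positivity)
  have hYm : ∀ k, Measurable[ℱ (k+1)] (Y k) := by
    intro k; rw [hY]; dsimp only
    by_cases h : k < n
    · simp only [h, dite_true]
      exact (hSm ⟨k, h⟩).mul ((hEm ⟨k, h⟩).mono (ℱ.mono (Nat.le_succ k)) le_rfl)
    · simp only [h, dite_false]
      exact measurable_const
  have hmart := mart_aux μ ℱ Y (fun _ => Real.exp l * Real.exp (l / 480 * s⁻¹)) hY0 hYB hYm (by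
    intro k M K hM0 hMK hM
    rw [hY]; dsimp only
    by_cases h : k < n
    · simp only [h, dite_true]
      have := step_aux (ℱ.le k) μ ε s l hs hs2 hs1 hl hls (P ⟨k, h⟩) (hP_meas ⟨k, h⟩) (hP_pos ⟨k, h⟩)
        (hP_sum ⟨k, h⟩) (V ⟨k, h⟩) ((hV_meas ⟨k, h⟩).mono (ℱ.le _) le_rfl) (hV_range ⟨k, h⟩)
        (hV_cdf ⟨k, h⟩)
        (fun ω => M ω * Real.exp (-(l^2 * Real.log (1/ε) - l / 480 * (Geps ε (P ⟨k, h⟩ ω) - s))))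
        (K * Real.exp (l / 480 * s⁻¹))
        (fun ω => mul_nonneg (hM0 ω) (Real.exp_pos _).le)
        (fun ω => mul_le_mul (hMK ω) (hE _ ω) (Real.exp_pos _).le ((hM0 ω).trans (hMK ω)))
        (hM.mul (hEm ⟨k, h⟩))
      calc _ = _ := integral_congr_ae (Filter.Eventually.of_forall fun ω => by ring)
        _ ≤ _ := this
        _ = _ := integral_congr_ae (Filter.Eventually.of_forall fun ω => by
          dsimp only
          rw [mul_assoc, ← Real.exp_add, neg_add_cancel, Real.exp_zero, mul_one])
    · simp [h]) n
  have hYi : Integrable (fun ω => ∏ i ∈ Finset.range n, Y i ω) μ := by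
    refine Integrable.of_bound (Measurable.aestronglyMeasurable ?_)
      (∏ i ∈ Finset.range n, (Real.exp l * Real.exp (l / 480 * s⁻¹))) (Filter.Eventually.of_forall ?_)
    · exact Finset.measurable_fun_prod _ fun i _ => (hYm i).mono (ℱ.le _) le_rfl
    · intro ω
      rw [Real.norm_eq_abs, abs_of_nonneg (Finset.prod_nonneg fun i _ => hY0 i ω)]
      exact Finset.prod_le_prod (fun i _ => hY0 i ω) fun i _ => hYB i ω
  have hmk := mul_meas_ge_le_integral_of_nonneg
    (Filter.Eventually.of_forall fun ω => Finset.prod_nonneg fun i _ => hY0 i ω) hYi (1/δ)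
  set T := {ω | 1/δ ≤ ∏ i ∈ Finset.range n, Y i ω} with hT
  have hTδ : μ.real T ≤ δ := by
    have := hmk.trans hmart
    rw [one_div, inv_mul_le_iff₀ hδ0, mul_one] at this
    exact this
  have hYexp : ∀ ω, ∏ i ∈ Finset.range n, Y i ω = Real.exp (-l * ∑ t, Sstat ε (V t ω)
      - n * (l^2 * Real.log (1/ε)) + l / 480 * (∑ t, Geps ε (P t ω) - n * s)) := by
    intro ω
    rw [Finset.prod_range, hY]
    simp only [Fin.is_lt, dite_true, ← Real.exp_add, ← Real.exp_sum]
    congr 1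
    simp only [Finset.sum_add_distrib, Finset.sum_neg_distrib, Finset.sum_sub_distrib, ← Finset.mul_sum,
      Finset.sum_const, Finset.card_univ, Fintype.card_fin, nsmul_eq_mul]
    ring
  have hsub : Tᶜ ⊆ {ω | (1/480) * ∑ t, Geps ε (P t ω)
              - 3 * (Real.sqrt (2 * n * Real.log (1/ε) * (n * ε)) + (3/2) * (n * ε) / s)
            ≤ ∑ t, Sstat ε (V t ω)} := by
    intro ω hω
    simp only [hT, Set.mem_compl_iff, Set.mem_ofPred_eq, not_le] at hω ⊢
    rw [hYexp, ← Real.lt_log_iff_exp_lt (by positivity), hℓ] at hω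
    have q1 : n * s * r ≤ Real.sqrt (2 * n * Real.log (1/ε) * (n * ε)) := by
      refine Real.le_sqrt_of_sq_le ?_
      rw [← hr2, ← hs2]
      have : 0 ≤ (n * s * r)^2 := by positivity
      nlinarith
    have q2 : (3/2) * (n * ε) / s = 3/2 * (n * s) := by rw [← hs2]; field_simp
    rw [q2]
    set X := ∑ t, Sstat ε (V t ω)
    set G := ∑ t, Geps ε (P t ω)
    rw [← hr2] at hω
    have q3 : l * (G / 480 - n * s / 480 - n * (l * r^2) - n * (s * (4 + r))) < l * X := by
      have : l * (n * (s * (4 + r))) = n * ε := by rw [← hs2, ← hlr]; ring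
      linarith
    have q4 := lt_of_mul_lt_mul_left q3 hl.le
    have q5 : l * r^2 ≤ s * r := by rw [← hlr]; nlinarith [mul_nonneg hl.le hr]
    have q6 := mul_le_mul_of_nonneg_left q5 hn0.le
    have q7 : 0 < n * s := by positivity
    have q8 : 0 ≤ n * s * r := by positivity
    linarith
  have hfin : 1 ≤ μ T + μ Tᶜ := by
    rw [← measure_univ (μ := μ), ← Set.union_compl_self T]
    exact measure_union_le _ _
  refine le_trans ?_ (measure_mono hsub)
  have hTe : μ T ≤ ENNReal.ofReal δ := by
    rw [← ofReal_measureReal (measure_ne_top μ T)]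
    exact ENNReal.ofReal_le_ofReal hTδ
  have h3 : 1 ≤ ENNReal.ofReal δ + μ Tᶜ := hfin.trans (by gcongr)
  calc ENNReal.ofReal (1 - 2 * δ) ≤ ENNReal.ofReal (1 - δ) := ENNReal.ofReal_le_ofReal (by linarith)
    _ = 1 - ENNReal.ofReal δ := by rw [ENNReal.ofReal_sub _ hδ0.le, ENNReal.ofReal_one]
    _ ≤ μ Tᶜ := tsub_le_iff_left.2 h3
end

section
/- Let Σ = {1,…,d}, n ≥ 1, δ ∈ (0,1), set ε = log(1/δ)/n and assume ε ≤ 1/4. Let (Ω, F, P) be a probability space with a filtration (F_t)_{t=0}^n; for each t let P_t be an F_{t−1}-measurable random probability vector on Σ with all entries positive, and V_t an F_t-measurable random variable in [0,1] with P(V_t ≤ x | F_{t−1}) = Σ_{a∈Σ} P_t(a) x^{1/P_t(a)} almost surely for every x ∈ [0,1]. Set τ = √(2 n log(1/ε) log(1/δ)) + (3/2)·log(1/δ)/√ε and let τ_⋆ ≤ τ be any threshold. Then with C = 1920, P( Σ_{t=1}^n G_ε(P_t) ≥ C τ and Σ_{t=1}^n S_ε(V_t) < τ_⋆ ) ≤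 2δ. -/
open MeasureTheory ProbabilityTheory

noncomputable def kf (ε l u : ℝ) : ℝ :=
  -(l/2) / (u * √u) + l^2 * (1/u^2 - (2 - √ε) / (u * √u))

noncomputable def Phi (ε l y : ℝ) : ℝ :=
  1 - l * ((√y)⁻¹ - (2 - √ε)) + l^2 * ((√y)⁻¹ - (2 - √ε))^2

lemma kf_contOn (ε l : ℝ) {a b : ℝ} (ha : 0 < a) : ContinuousOn (kf ε l) (Set.Icc a b) := by
  intro u hu
  have h0 : 0 < u := lt_of_lt_of_le ha hu.1
  have h1 : u * √u ≠ 0 := by positivity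
  have h2 : u^2 ≠ 0 := by positivity
  apply ContinuousAt.continuousWithinAt
  unfold kf
  fun_prop (disch := assumption)

lemma hasDeriv_Phi (ε l u : ℝ) (hu : 0 < u) : HasDerivAt (fun y => -Phi ε l y) (kf ε l u) u := by
  have h1 : HasDerivAt (fun y => (√y)⁻¹) (-(1/(2*√u)) / (√u)^2) u :=
    (Real.hasDerivAt_sqrt hu.ne').inv (by positivity)
  have h2 := h1.sub_const (2 - √ε)
  have h3 := (((h2.const_mul l).const_sub 1).add ((h2.pow 2).const_mul (l^2))).neg
  unfold Phi
  refine h3.congr_deriv ?_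
  unfold kf
  have hs : 0 < √u := Real.sqrt_pos.2 hu
  have hsq : u = √u ^ 2 := (Real.sq_sqrt hu.le).symm
  generalize √u = r at *
  subst hsq
  have hr : r ≠ 0 := hs.ne'
  simp only [Nat.cast_ofNat, Nat.add_one_sub_one, pow_one]
  field_simp
  ring

lemma int_kf (ε l : ℝ) {a : ℝ} (ha : 0 < a) (ha1 : a ≤ 1) :
    ∫ u in Set.Ioc a 1, kf ε l u = Phi ε l a - Phi ε l 1 := by
  rw [← intervalIntegral.integral_of_le ha1,
    intervalIntegral.integral_eq_sub_of_hasDerivAt (f := fun y => -Phi ε l y)]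
  · ring
  · intro x hx
    rw [Set.uIcc_of_le ha1] at hx
    exact hasDeriv_Phi ε l x (lt_of_lt_of_le ha hx.1)
  · apply ContinuousOn.intervalIntegrable
    rw [Set.uIcc_of_le ha1]
    exact kf_contOn ε l ha

lemma int_ukf (ε l : ℝ) (hε : 0 < ε) (hε1 : ε ≤ 1) :
    ∫ u in Set.Ioc ε 1, u * kf ε l u =
      -l * (1 - √ε) + l^2 * (Real.log (1/ε) - 2 * (2 - √ε) * (1 - √ε)) := by
  rw [← intervalIntegral.integral_of_le hε1,
    intervalIntegral.integral_eq_sub_of_hasDerivAt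
      (f := fun y => -l * √y + l^2 * (Real.log y - 2 * (2 - √ε) * √y))]
  · simp; ring
  · intro x hx
    rw [Set.uIcc_of_le hε1] at hx
    have hx0 : 0 < x := lt_of_lt_of_le hε hx.1
    have h1 := Real.hasDerivAt_sqrt hx0.ne'
    have h2 := Real.hasDerivAt_log hx0.ne'
    refine ((h1.const_mul (-l)).add ((h2.sub (h1.const_mul (2 * (2 - √ε)))).const_mul (l^2))).congr_deriv ?_
    unfold kf
    have hs : 0 < √x := Real.sqrt_pos.2 hx0
    field_simp
    try ring
  · apply ContinuousOn.intervalIntegrable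
    rw [Set.uIcc_of_le hε1]
    exact continuousOn_id.mul (kf_contOn ε l hε)

lemma layer (ε l v : ℝ) (hε : 0 < ε) (hε1 : ε ≤ 1) (hv : v ∈ Set.Icc (0:ℝ) 1) :
    ∫ u in Set.Ioc ε 1, (if v ≤ 1 - u then 0 else 1) * kf ε l u
      = (1 - l * Sstat ε v + l^2 * (Sstat ε v)^2) - Phi ε l 1 := by
  have h1 : ∀ u, (if v ≤ 1 - u then (0:ℝ) else 1) * kf ε l u
      = (Set.Ioi (1 - v)).indicator (kf ε l) u := by
    intro u
    by_cases h : v ≤ 1 - u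
    · have : u ∉ Set.Ioi (1 - v) := by simp; linarith
      simp [h, Set.indicator_of_notMem this]
    · have : u ∈ Set.Ioi (1 - v) := by simp; linarith
      simp [h, Set.indicator_of_mem this]
  simp_rw [h1]
  rw [setIntegral_indicator measurableSet_Ioi, Set.Ioc_inter_Ioi,
    int_kf ε l (lt_of_lt_of_le hε (le_max_left _ _)) (max_le hε1 (by linarith [hv.1]))]
  have h2 : Sstat ε v = (√(max ε (1 - v)))⁻¹ - (2 - √ε) := by
    unfold Sstat
    congr 1
    split_ifs with h
    · rcases le_total ε (1 - v) with h' | h'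
      · rw [max_eq_right h', min_eq_right]
        exact inv_anti₀ (Real.sqrt_pos.2 hε) (Real.sqrt_le_sqrt h')
      · rw [max_eq_left h', min_eq_left]
        exact inv_anti₀ (Real.sqrt_pos.2 (by linarith)) (Real.sqrt_le_sqrt h')
    · rw [max_eq_left]
      linarith
  rw [h2]
  unfold Phi
  ring

lemma exp_le_quad (x : ℝ) (hx : x ≤ 1) : Real.exp x ≤ 1 + x + x^2 := by
  by_cases h : -1 ≤ x
  · have := Real.abs_exp_sub_one_sub_id_le (x := x) (abs_le.2 ⟨h, hx⟩)
    linarith [(abs_le.1 this).2]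
  · have h1 : Real.exp x ≤ 1 := Real.exp_le_one_iff.2 (by linarith)
    nlinarith

lemma Sstat_ge (ε v : ℝ) (hε : 0 < ε) (hε1 : ε ≤ 1) (hv : v ∈ Set.Icc (0:ℝ) 1) : -1 ≤ Sstat ε v := by
  have h1 : √ε ≤ 1 := Real.sqrt_le_one.2 hε1
  have h2 : 0 < √ε := Real.sqrt_pos.2 hε
  have h3 : 1 ≤ (√ε)⁻¹ := (one_le_inv₀ h2).2 h1
  unfold Sstat
  split_ifs with h
  · have h4 : 1 ≤ (√(1 - v))⁻¹ :=
      (one_le_inv₀ (Real.sqrt_pos.2 (by linarith))).2 (Real.sqrt_le_one.2 (by linarith [hv.1]))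
    have := le_min h3 h4
    linarith
  · linarith

lemma Sstat_le (ε v : ℝ) (hε1 : ε ≤ 1) : Sstat ε v ≤ (√ε)⁻¹ := by
  have h1 : √ε ≤ 1 := Real.sqrt_le_one.2 hε1
  unfold Sstat
  split_ifs with h
  · have := min_le_left (√ε)⁻¹ (√(1 - v))⁻¹
    linarith
  · linarith

/-- weight -/
noncomputable def hh (ε p : ℝ) : ℝ := if p ≤ 1/2 then p / √(max p ε) else 0

lemma hh_nonneg (ε p : ℝ) (hp : 0 ≤ p) : 0 ≤ hh ε p := by
  unfold hh; split_ifs <;> positivity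

lemma hh_le (ε p : ℝ) (hε : 0 < ε) (hp : 0 ≤ p) : hh ε p ≤ p / √ε := by
  unfold hh; split_ifs
  · apply div_le_div_of_nonneg_left hp (Real.sqrt_pos.2 hε) (Real.sqrt_le_sqrt (le_max_right _ _))
  · positivity

lemma J_nonneg (p u : ℝ) (hp : 0 < p) (hp1 : p ≤ 1) (hu : u ∈ Set.Icc (0:ℝ) 1) :
    0 ≤ (1 - u) - (1 - u) ^ (1/p) := by
  have : (1 - u) ^ (1/p) ≤ (1-u)^(1:ℝ) := by
    rcases eq_or_lt_of_le (show 0 ≤ 1 - u by linarith [hu.2]) with h | h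
    · rw [← h, Real.zero_rpow (by positivity), Real.zero_rpow (by norm_num)]
    · exact Real.rpow_le_rpow_of_exponent_ge h (by linarith [hu.1]) ((one_le_div hp).2 hp1)
  rw [Real.rpow_one] at this
  linarith

lemma J_contOn (p a : ℝ) (ha : 0 < a) (hp : 0 < p) :
    ContinuousOn (fun u : ℝ => ((1 - u) - (1 - u) ^ (1/p)) / (u * √u)) (Set.Icc a 1) := by
  apply ContinuousOn.div
  · apply Continuous.continuousOn
    have : Continuous fun u : ℝ => (1 - u) ^ (1/p) :=
      (continuous_const.sub continuous_id).rpow_const (fun _ => Or.inr (by positivity))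
    fun_prop
  · fun_prop
  · intro u hu
    have : 0 < u := lt_of_lt_of_le ha hu.1
    positivity

lemma J_ge (ε p : ℝ) (hε : 0 < ε) (hε1 : ε ≤ 1/4) (hp : 0 < p) (hp1 : p ≤ 1) :
    1/40 * hh ε p ≤ p * ∫ u in Set.Ioc ε 1, ((1 - u) - (1 - u) ^ (1/p)) / (u * √u) := by
  have hnn : ∀ u ∈ Set.Ioc ε 1, 0 ≤ ((1 - u) - (1 - u) ^ (1/p)) / (u * √u) := by
    intro u hu
    have : 0 < u := lt_trans hε hu.1
    exact div_nonneg (J_nonneg p u hp hp1 ⟨this.le, hu.2⟩) (by positivity)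
  unfold hh
  split_ifs with h
  swap
  · rw [mul_zero]
    exact mul_nonneg hp.le (setIntegral_nonneg measurableSet_Ioc hnn)
  set q := max p ε with hq
  have hq0 : 0 < q := lt_of_lt_of_le hp (le_max_left _ _)
  have hqp : p ≤ q := le_max_left _ _
  have hqe : ε ≤ q := le_max_right _ _
  have hq1 : q ≤ 1/2 := max_le h (by linarith)
  have hsub : Set.Ioc q (3*q/2) ⊆ Set.Ioc ε 1 := Set.Ioc_subset_Ioc hqe (by linarith)
  have hintg : IntegrableOn (fun u : ℝ => ((1 - u) - (1 - u) ^ (1/p)) / (u * √u)) (Set.Ioc ε 1) :=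
    ((J_contOn p ε hε hp).integrableOn_Icc).mono_set Set.Ioc_subset_Icc_self
  have h1 : ∫ u in Set.Ioc q (3*q/2), ((1 - u) - (1 - u) ^ (1/p)) / (u * √u)
      ≤ ∫ u in Set.Ioc ε 1, ((1 - u) - (1 - u) ^ (1/p)) / (u * √u) :=
    setIntegral_mono_set hintg ((ae_restrict_iff' measurableSet_Ioc).2 (.of_forall hnn))
      (.of_forall hsub)
  have hs0 : 0 < √q := Real.sqrt_pos.2 hq0
  have h2 : ∀ u ∈ Set.Ioc q (3*q/2), 1/20 / (q * √q) ≤ ((1 - u) - (1 - u) ^ (1/p)) / (u * √u) := by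
    intro u hu
    have hu0 : 0 < u := lt_trans hq0 hu.1
    have hu1 : u ≤ 3/4 := by linarith [hu.2]
    have hexp : (1 - u) ^ (1/p) ≤ (1 - u) * (61/100) := by
      have e1 : (1 - u) ^ (1/p) = (1 - u) * (1-u)^(1/p - 1) := by
        rw [Real.rpow_sub (by linarith), Real.rpow_one]
        have : 1 - u ≠ 0 := by linarith
        field_simp
      rw [e1]
      apply mul_le_mul_of_nonneg_left _ (by linarith)
      have e2 : (1-u)^(1/p-1) ≤ Real.exp (-(1/2)) := by
        rw [Real.rpow_def_of_pos (by linarith)]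
        apply Real.exp_le_exp.2
        have e3 : Real.log (1 - u) ≤ -u := by
          have := Real.log_le_sub_one_of_pos (show 0 < 1 - u by linarith); linarith
        have e4 : 0 ≤ 1/p - 1 := by
          have := (one_le_div hp).2 hp1; linarith
        have e5 : 1/2 ≤ u * (1/p - 1) := by
          have : p * (1/p - 1) = 1 - p := by field_simp
          have : p * (1/p - 1) ≤ u * (1/p-1) := mul_le_mul_of_nonneg_right (by linarith [hu.1]) e4
          linarith
        nlinarith
      have e6 : Real.exp (-(1/2)) ≤ 61/100 := by
        rw [Real.exp_neg]
        have := Real.quadratic_le_exp_of_nonneg (show (0:ℝ) ≤ 1/2 by norm_num)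
        have h7 : (1.645:ℝ) ≤ Real.exp (1/2) := by
          have := Real.sum_le_exp_of_nonneg (show (0:ℝ) ≤ 1/2 by norm_num) 4
          norm_num [Finset.sum_range_succ, Nat.factorial] at this
          norm_num
          linarith
        calc (Real.exp (1/2))⁻¹ ≤ (1.645)⁻¹ := inv_anti₀ (by norm_num) h7
          _ ≤ _ := by norm_num
      linarith
    have hnum : 39/400 ≤ (1 - u) - (1 - u) ^ (1/p) := by nlinarith
    have hden : u * √u ≤ (1.9) * (q * √q) := by
      have : √u ≤ 1.25 * √q := by
        rw [Real.sqrt_le_left (by positivity), mul_pow, Real.sq_sqrt hq0.le]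
        nlinarith [hu.2]
      calc u * √u ≤ (3*q/2) * (1.25 * √q) := by gcongr; exact hu.2
        _ ≤ _ := by nlinarith [mul_pos hq0 hs0]
    have : 0 < u * √u := by positivity
    rw [div_le_div_iff₀ (by positivity) this]
    nlinarith [mul_pos hq0 hs0]
  have h3 : 1/40 / √q ≤ ∫ u in Set.Ioc q (3*q/2), ((1 - u) - (1 - u) ^ (1/p)) / (u * √u) := by
    have := setIntegral_mono_on (μ := volume) (f := fun _ => 1/20 / (q * √q)) (s := Set.Ioc q (3*q/2))
      (by simp [integrableOn_const_iff]) (hintg.mono_set hsub) measurableSet_Ioc h2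
    refine le_trans (le_of_eq ?_) this
    rw [setIntegral_const]
    simp only [Measure.real, Real.volume_Ioc, smul_eq_mul]
    rw [ENNReal.toReal_ofReal (by linarith)]
    field_simp
    ring
  calc 1/40 * (p / √q) = p * (1/40 / √q) := by ring
    _ ≤ _ := mul_le_mul_of_nonneg_left (h3.trans h1) hp.le

lemma kf_le (ε l u : ℝ) (hε : 0 < ε) (hε1 : ε ≤ 1/4) (hl : 0 ≤ l) (hl1 : l ≤ √ε / 4) (hu : ε ≤ u) :
    kf ε l u ≤ -(l/4) / (u * √u) := by
  have hu0 : 0 < u := lt_of_lt_of_le hε hu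
  have hs : √ε ≤ √u := Real.sqrt_le_sqrt hu
  have hs1 : √ε ≤ 1 := Real.sqrt_le_one.2 (by linarith)
  have hsu : 0 < √u := Real.sqrt_pos.2 hu0
  unfold kf
  have h1 : (0:ℝ) ≤ l^2 * ((2 - √ε) / (u * √u)) := by
    have : 0 ≤ 2 - √ε := by linarith
    positivity
  have h2 : l^2 * (1/u^2) ≤ (l/4) / (u * √u) := by
    rw [mul_one_div, div_le_div_iff₀ (by positivity) (by positivity)]
    have e : u^2 = u * √u * √u := by rw [mul_assoc, Real.mul_self_sqrt hu0.le]; ring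
    rw [e]
    have : l * (l * (u * √u)) ≤ l * (√u / 4 * (u * √u)) := by gcongr; linarith
    nlinarith
  have h3 : -(l/2) / (u * √u) = -(l/4) / (u * √u) - (l/4) / (u * √u) := by ring
  rw [h3, mul_sub]
  linarith

lemma Q_le {d : ℕ} (ε l : ℝ) (hε : 0 < ε) (hε1 : ε ≤ 1/4) (hl : 0 ≤ l) (hl1 : l ≤ √ε / 4)
    (p : Fin d → ℝ) (hp : ∀ a, 0 < p a) (hsum : ∑ a, p a = 1) :
    Phi ε l 1 + ∫ u in Set.Ioc ε 1, (1 - ∑ a, p a * (1 - u) ^ (1 / p a)) * kf ε l u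
      ≤ Real.exp (l^2 * Real.log (1/ε) - l/160 * ∑ a, hh ε (p a)) := by
  have hp1 : ∀ a, p a ≤ 1 := fun a => by
    rw [← hsum]; exact Finset.single_le_sum (fun b _ => (hp b).le) (Finset.mem_univ a)
  have hJi : ∀ a, IntegrableOn (fun u : ℝ => ((1 - u) - (1 - u) ^ (1/p a)) / (u * √u)) (Set.Ioc ε 1) :=
    fun a => ((J_contOn (p a) ε hε (hp a)).integrableOn_Icc).mono_set Set.Ioc_subset_Icc_self
  have hki : IntegrableOn (fun u => u * kf ε l u) (Set.Ioc ε 1) :=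
    ((continuousOn_id.mul (kf_contOn ε l hε)).integrableOn_Icc).mono_set Set.Ioc_subset_Icc_self
  have hfi : IntegrableOn (fun u => (1 - ∑ a, p a * (1 - u) ^ (1 / p a)) * kf ε l u) (Set.Ioc ε 1) := by
    refine (ContinuousOn.integrableOn_Icc ?_).mono_set Set.Ioc_subset_Icc_self
    refine ContinuousOn.mul (Continuous.continuousOn ?_) (kf_contOn ε l hε)
    refine continuous_const.sub (continuous_finsetSum _ fun a _ => continuous_const.mul ?_)
    exact (continuous_const.sub continuous_id).rpow_const
      (fun _ => Or.inr (by have := hp a; positivity))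
  have hgi : IntegrableOn (fun u => (l/4) * ∑ a, p a * (((1 - u) - (1 - u) ^ (1/p a)) / (u * √u)))
      (Set.Ioc ε 1) := by
    refine Integrable.const_mul (integrable_finsetSum _ fun a _ => ?_) _
    exact (hJi a).const_mul _
  have h1 : ∀ u ∈ Set.Ioc ε 1, (1 - ∑ a, p a * (1 - u) ^ (1 / p a)) * kf ε l u
      ≤ u * kf ε l u - (l/4) * ∑ a, p a * (((1 - u) - (1 - u) ^ (1/p a)) / (u * √u)) := by
    intro u hu
    have hu0 : 0 < u := lt_trans hε hu.1
    have e1 : 1 - ∑ a, p a * (1 - u) ^ (1 / p a)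
        = u + ∑ a, p a * ((1 - u) - (1 - u) ^ (1 / p a)) := by
      simp_rw [mul_sub, Finset.sum_sub_distrib, mul_one, ← Finset.sum_mul]
      rw [hsum]; ring
    have e2 : 0 ≤ ∑ a, p a * ((1 - u) - (1 - u) ^ (1 / p a)) :=
      Finset.sum_nonneg fun a _ => mul_nonneg (hp a).le (J_nonneg _ u (hp a) (hp1 a) ⟨hu0.le, hu.2⟩)
    have e3 : ∑ a, p a * (((1 - u) - (1 - u) ^ (1/p a)) / (u * √u))
        = (∑ a, p a * ((1 - u) - (1 - u) ^ (1 / p a))) / (u * √u) := by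
      rw [Finset.sum_div]; exact Finset.sum_congr rfl fun a _ => by ring
    rw [e1, e3, add_mul]
    have := mul_le_mul_of_nonneg_left (kf_le ε l u hε hε1 hl hl1 hu.1.le) e2
    have e4 : ∀ x : ℝ, x * (-(l/4) / (u * √u)) = -((l/4) * (x / (u * √u))) := fun x => by ring
    rw [e4] at this
    linarith
  have h2 := setIntegral_mono_on hfi (hki.sub hgi) measurableSet_Ioc h1
  simp only [Pi.sub_apply] at h2
  rw [integral_sub hki hgi, int_ukf ε l hε (by linarith), integral_const_mul,
    integral_finsetSum _ (fun a _ => (hJi a).const_mul _)] at h2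
  simp_rw [integral_const_mul] at h2
  have h3 : 1/40 * ∑ a, hh ε (p a) ≤
      ∑ a, p a * ∫ u in Set.Ioc ε 1, ((1 - u) - (1 - u) ^ (1/p a)) / (u * √u) := by
    rw [Finset.mul_sum]
    exact Finset.sum_le_sum fun a _ => J_ge ε (p a) hε hε1 (hp a) (hp1 a)
  have h4 := mul_le_mul_of_nonneg_left h3 (show 0 ≤ l/4 by positivity)
  have hs1 : √ε ≤ 1 := Real.sqrt_le_one.2 (by linarith)
  have h5 : Phi ε l 1 = 1 + l * (1 - √ε) + l^2 * (1 - √ε)^2 := by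
    unfold Phi; simp; ring
  have h6 : l^2 * ((1 - √ε)^2 - 2 * (2 - √ε) * (1 - √ε)) ≤ 0 := by
    apply mul_nonpos_of_nonneg_of_nonpos (by positivity)
    nlinarith [Real.sqrt_nonneg ε]
  have h7 := Real.add_one_le_exp (l^2 * Real.log (1/ε) - l/160 * ∑ a, hh ε (p a))
  rw [h5]
  nlinarith

lemma Geps_le {d : ℕ} (ε : ℝ) (hε : 0 < ε) (hε1 : ε ≤ 1/4)
    (p : Fin d → ℝ) (hp : ∀ a, 0 < p a) (hsum : ∑ a, p a = 1) :
    Geps ε p ≤ 2 * ∑ a, hh ε (p a) + √ε / 4 := by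
  have hp1 : ∀ a, p a ≤ 1 := fun a => by
    rw [← hsum]; exact Finset.single_le_sum (fun b _ => (hp b).le) (Finset.mem_univ a)
  have hs0 : 0 < √ε := Real.sqrt_pos.2 hε
  set g : Fin d → ℝ := fun a => if p a ≤ ε then p a * (1 - p a) / √ε else √(p a * (1 - p a)) with hg
  have hG : Geps ε p = ∑ a, g a := by
    unfold Geps Gq
    rw [Finset.sum_div, ← Finset.sum_add_distrib]
    refine Finset.sum_congr rfl fun a _ => ?_
    simp only [peps, pepsC, hg]
    by_cases h : p a ≤ ε
    · have h' : ¬ ε < p a := not_lt.2 h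
      simp [h, h']
    · have h' : ε < p a := not_le.1 h
      simp [h, h', Real.sqrt_eq_rpow]
  have hle : ∀ a, p a ≤ 1/2 → g a ≤ hh ε (p a) := by
    intro a ha
    have h0 := hp a
    simp only [hg, hh, if_pos ha]
    split_ifs with h
    · rw [max_eq_right h]
      gcongr
      nlinarith
    · rw [max_eq_left (not_le.1 h).le, Real.div_sqrt]
      apply Real.sqrt_le_sqrt
      nlinarith
  have hnn : ∀ a, 0 ≤ hh ε (p a) := fun a => hh_nonneg _ _ (hp a).le
  rw [hG]
  by_cases hbig : ∃ a, 1/2 < p a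
  · obtain ⟨a, ha⟩ := hbig
    have hT : ∑ b ∈ Finset.univ.erase a, p b = 1 - p a := by
      rw [← hsum, ← Finset.add_sum_erase _ p (Finset.mem_univ a)]; ring
    set T := 1 - p a with hTdef
    have hT0 : 0 ≤ T := by linarith [hp1 a]
    have hbT : ∀ b ∈ Finset.univ.erase a, p b ≤ T := fun b hb => by
      rw [← hT]; exact Finset.single_le_sum (fun b _ => (hp b).le) hb
    have hgs : ∑ b ∈ Finset.univ.erase a, g b ≤ ∑ b ∈ Finset.univ.erase a, hh ε (p b) :=
      Finset.sum_le_sum fun b hb => hle b (by linarith [hbT b hb])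
    have hga : g a ≤ √T := by
      simp only [hg]
      rw [if_neg (by linarith)]
      apply Real.sqrt_le_sqrt
      nlinarith [hp1 a]
    have hm : 0 < √(max T ε) := Real.sqrt_pos.2 (lt_of_lt_of_le hε (le_max_right _ _))
    have hH : T / √(max T ε) ≤ ∑ b ∈ Finset.univ.erase a, hh ε (p b) := by
      nth_rw 1 [← hT]
      rw [Finset.sum_div]
      refine Finset.sum_le_sum fun b hb => ?_
      unfold hh
      rw [if_pos (by linarith [hbT b hb])]
      have := hp b
      have := hbT b hb
      gcongr
    have hTT : √T ≤ T / √(max T ε) + √ε / 4 := by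
      rcases le_total ε T with h | h
      · rw [max_eq_left h, Real.div_sqrt]; linarith
      · rw [max_eq_right h]
        have e1 : √T ^ 2 = T := Real.sq_sqrt hT0
        rw [← sub_le_iff_le_add, le_div_iff₀ hs0]
        nlinarith [sq_nonneg (√T - √ε / 2)]
    rw [← Finset.add_sum_erase _ g (Finset.mem_univ a),
      ← Finset.add_sum_erase _ (fun a => hh ε (p a)) (Finset.mem_univ a)]
    have := hnn a
    linarith
  · push Not at hbig
    have h1 : ∑ a, g a ≤ ∑ a, hh ε (p a) := Finset.sum_le_sum fun a _ => hle a (hbig a)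
    have h2 : 0 ≤ ∑ a, hh ε (p a) := Finset.sum_nonneg fun a _ => hnn a
    linarith

lemma cond_pull {Ω : Type*} {m m0 : MeasurableSpace Ω} (hm : m ≤ m0) (μ : Measure Ω)
    [IsProbabilityMeasure μ] (W : Ω → ℝ) (hW : Measurable[m] W) (K : ℝ) (hWK : ∀ ω, |W ω| ≤ K)
    (f g : Ω → ℝ) (hf : Measurable f) (hf1 : ∀ ω, |f ω| ≤ 1) (hfg : μ[f | m] =ᵐ[μ] g) :
    ∫ ω, W ω * f ω ∂μ = ∫ ω, W ω * g ω ∂μ := by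
  have hfi : Integrable f μ := Integrable.of_bound hf.aestronglyMeasurable 1 (.of_forall hf1)
  have hWf : Integrable (W * f) μ :=
    hfi.bdd_mul (hW.mono hm le_rfl).aestronglyMeasurable (.of_forall hWK)
  have h1 := condExp_mul_of_stronglyMeasurable_left (μ := μ) hW.stronglyMeasurable hWf hfi
  have h2 := integral_condExp (μ := μ) hm (f := W * f)
  calc ∫ ω, W ω * f ω ∂μ = ∫ ω, (μ[W * f | m]) ω ∂μ := h2.symm
    _ = ∫ ω, W ω * g ω ∂μ := by
      apply integral_congr_ae
      filter_upwards [h1, hfg] with ω e1 e2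
      rw [e1, Pi.mul_apply, e2]

lemma measurable_Sstat (ε : ℝ) : Measurable (Sstat ε) := by
  unfold Sstat
  refine Measurable.sub_const (Measurable.ite measurableSet_Iio ?_ measurable_const) _
  fun_prop

lemma measurable_hh (ε : ℝ) : Measurable (hh ε) := by
  unfold hh
  refine Measurable.ite measurableSet_Iic ?_ measurable_const
  fun_prop

lemma one_step {Ω : Type*} {m m0 : MeasurableSpace Ω} (hm : m ≤ m0) (μ : Measure Ω)
    [IsProbabilityMeasure μ] {d : ℕ} (ε l : ℝ) (hε : 0 < ε) (hε1 : ε ≤ 1/4) (hl : 0 ≤ l)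
    (hl1 : l ≤ √ε / 4)
    (W : Ω → ℝ) (hW : Measurable[m] W) (K : ℝ) (hWK : ∀ ω, |W ω| ≤ K) (hW0 : ∀ ω, 0 ≤ W ω)
    (P : Ω → Fin d → ℝ) (hP : Measurable[m] P) (hp : ∀ ω a, 0 < P ω a)
    (hsum : ∀ ω, ∑ a, P ω a = 1)
    (V : Ω → ℝ) (hV : Measurable V) (hVr : ∀ ω, V ω ∈ Set.Icc (0:ℝ) 1)
    (hcdf : ∀ x ∈ Set.Icc (0:ℝ) 1,
      (μ[(fun ω => if V ω ≤ x then (1:ℝ) else 0) | m])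
        =ᵐ[μ] fun ω => ∑ a, P ω a * x ^ (1 / P ω a)) :
    ∫ ω, W ω * Real.exp (-l * Sstat ε (V ω)) ∂μ
      ≤ ∫ ω, W ω * Real.exp (l^2 * Real.log (1/ε) - l/160 * ∑ a, hh ε (P ω a)) ∂μ := by
  have hW' : Measurable W := hW.mono hm le_rfl
  have hP' : Measurable P := hP.mono hm le_rfl
  have hPa : ∀ a, Measurable (fun ω => P ω a) := fun a => (measurable_pi_apply a).comp hP'
  have hK : 0 ≤ K := by
    obtain ⟨ω⟩ : Nonempty Ω := nonempty_of_isProbabilityMeasure μ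
    exact (abs_nonneg _).trans (hWK ω)
  have hWi : Integrable W μ := Integrable.of_bound hW'.aestronglyMeasurable K (.of_forall hWK)
  have hkm : Measurable (kf ε l) := by unfold kf; fun_prop
  have hs1 : √ε ≤ 1 := Real.sqrt_le_one.2 (by linarith)
  have hs0 : 0 < √ε := Real.sqrt_pos.2 hε
  obtain ⟨M, hM⟩ := isCompact_Icc.exists_bound_of_continuousOn (kf_contOn ε l (b := 1) hε)
  have hki : Integrable (kf ε l) (volume.restrict (Set.Ioc ε 1)) :=
    ((kf_contOn ε l hε).integrableOn_Icc).mono_set Set.Ioc_subset_Icc_self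
  have hWk : Integrable (fun z : Ω × ℝ => W z.1 * kf ε l z.2)
      (μ.prod (volume.restrict (Set.Ioc ε 1))) := hWi.mul_prod hki
  set I : Ω → ℝ → ℝ := fun ω u => if V ω ≤ 1 - u then 0 else 1 with hI
  set F : Ω → ℝ → ℝ := fun ω u => 1 - ∑ a, P ω a * (1 - u) ^ (1 / P ω a) with hF
  have hIm : Measurable (fun z : Ω × ℝ => I z.1 z.2) := by
    refine Measurable.ite (measurableSet_le (hV.comp measurable_fst) ?_) measurable_const measurable_const
    fun_prop
  have hFm : Measurable (fun z : Ω × ℝ => F z.1 z.2) := by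
    refine measurable_const.sub (Finset.measurable_sum _ fun a _ => ?_)
    have h1 : Measurable (fun z : Ω × ℝ => P z.1 a) := (hPa a).comp measurable_fst
    have h2 : Measurable (fun z : Ω × ℝ => 1 - z.2) := by fun_prop
    exact h1.mul (h2.pow (measurable_const.div h1))
  have hI1 : ∀ ω u, |I ω u| ≤ 1 := by
    intro ω u; simp only [hI]; split_ifs <;> simp
  have hF1 : ∀ ω, ∀ u ∈ Set.Icc (0:ℝ) 1, |F ω u| ≤ 1 := by
    intro ω u hu
    have h1 : 0 ≤ ∑ a, P ω a * (1 - u) ^ (1 / P ω a) := Finset.sum_nonneg fun a _ =>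
      mul_nonneg (hp ω a).le (Real.rpow_nonneg (by linarith [hu.2]) _)
    have h2 : ∑ a, P ω a * (1 - u) ^ (1 / P ω a) ≤ 1 := by
      refine le_trans ?_ (hsum ω).le
      refine Finset.sum_le_sum fun a _ => mul_le_of_le_one_right (hp ω a).le ?_
      exact Real.rpow_le_one (by linarith [hu.2]) (by linarith [hu.1]) (one_div_nonneg.2 (hp ω a).le)
    simp only [hF]
    rw [abs_le]; constructor <;> linarith
  have hae : ∀ᵐ z ∂(μ.prod (volume.restrict (Set.Ioc ε 1))), z.2 ∈ Set.Ioc ε 1 := by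
    have : ∀ᵐ u ∂(volume.restrict (Set.Ioc ε 1)), u ∈ Set.Ioc ε 1 := ae_restrict_mem measurableSet_Ioc
    exact Measure.quasiMeasurePreserving_snd.ae this
  have hWIk : Integrable (fun z : Ω × ℝ => I z.1 z.2 * (W z.1 * kf ε l z.2))
      (μ.prod (volume.restrict (Set.Ioc ε 1))) :=
    hWk.bdd_mul hIm.aestronglyMeasurable (.of_forall fun z => hI1 z.1 z.2)
  have hWFk : Integrable (fun z : Ω × ℝ => F z.1 z.2 * (W z.1 * kf ε l z.2))
      (μ.prod (volume.restrict (Set.Ioc ε 1))) := by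
    refine hWk.bdd_mul (c := 1) hFm.aestronglyMeasurable ?_
    filter_upwards [hae] with z hz
    exact hF1 z.1 z.2 ⟨(hε.trans hz.1).le, hz.2⟩
  have key : ∀ u ∈ Set.Ioc ε 1, ∫ ω, I ω u * (W ω * kf ε l u) ∂μ = ∫ ω, F ω u * (W ω * kf ε l u) ∂μ := by
    intro u hu
    have hx : 1 - u ∈ Set.Icc (0:ℝ) 1 := ⟨by linarith [hu.2], by linarith [hu.1]⟩
    have h1 := cond_pull hm μ W hW K hWK (fun ω => if V ω ≤ 1 - u then (1:ℝ) else 0) _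
      (Measurable.ite (measurableSet_le hV measurable_const) measurable_const measurable_const)
      (fun ω => by split_ifs <;> simp) (hcdf (1 - u) hx)
    have hIu : Measurable (fun ω => I ω u) := hIm.comp (measurable_id.prodMk measurable_const)
    have hFu : Measurable (fun ω => F ω u) := hFm.comp (measurable_id.prodMk measurable_const)
    have i1 : Integrable (fun ω => W ω * (if V ω ≤ 1 - u then (1:ℝ) else 0)) μ := by
      refine hWi.mul_bdd (c := 1) (Measurable.aestronglyMeasurable ?_) (.of_forall fun ω => ?_)
      · exact Measurable.ite (measurableSet_le hV measurable_const) measurable_const measurable_const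
      · split_ifs <;> simp
    have i2 : Integrable (fun ω => W ω * F ω u) μ :=
      hWi.mul_bdd (c := 1) hFu.aestronglyMeasurable
        (.of_forall fun ω => hF1 ω u ⟨(hε.trans hu.1).le, hu.2⟩)
    have i3 : Integrable (fun ω => W ω * ∑ a, P ω a * (1 - u) ^ (1 / P ω a)) μ := by
      refine (hWi.sub i2).congr (.of_forall fun ω => ?_)
      simp only [hF, Pi.sub_apply]; ring
    have e1 : ∀ ω, I ω u * (W ω * kf ε l u)
        = kf ε l u * (W ω - W ω * (if V ω ≤ 1 - u then (1:ℝ) else 0)) := by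
      intro ω; simp only [hI]; split_ifs <;> ring
    have e2 : ∀ ω, F ω u * (W ω * kf ε l u)
        = kf ε l u * (W ω - W ω * ∑ a, P ω a * (1 - u) ^ (1 / P ω a)) := by
      intro ω; simp only [hF]; ring
    simp_rw [e1, e2, integral_const_mul]
    rw [integral_sub hWi i1, integral_sub hWi i3, h1]
  have swap : ∫ ω, (∫ u in Set.Ioc ε 1, I ω u * (W ω * kf ε l u)) ∂μ
      = ∫ ω, (∫ u in Set.Ioc ε 1, F ω u * (W ω * kf ε l u)) ∂μ := by
    have s1 := integral_integral_swap (f := fun ω u => I ω u * (W ω * kf ε l u)) hWIk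
    have s2 := integral_integral_swap (f := fun ω u => F ω u * (W ω * kf ε l u)) hWFk
    exact s1.trans ((setIntegral_congr_fun measurableSet_Ioc key).trans s2.symm)
  have c1 : ∀ ω, ∫ u in Set.Ioc ε 1, I ω u * (W ω * kf ε l u)
      = W ω * ((1 - l * Sstat ε (V ω) + l^2 * (Sstat ε (V ω))^2) - Phi ε l 1) := by
    intro ω
    rw [← layer ε l (V ω) hε (by linarith) (hVr ω), ← integral_const_mul]
    congr 1; funext u; simp only [hI]; ring
  have c2 : ∀ ω, ∫ u in Set.Ioc ε 1, F ω u * (W ω * kf ε l u)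
      = W ω * ∫ u in Set.Ioc ε 1, F ω u * kf ε l u := by
    intro ω
    rw [← integral_const_mul]
    congr 1; funext u; ring
  have j1 : Integrable (fun ω => W ω * ((1 - l * Sstat ε (V ω) + l^2 * (Sstat ε (V ω))^2) - Phi ε l 1)) μ :=
    hWIk.integral_prod_left.congr (.of_forall c1)
  have j2 : Integrable (fun ω => W ω * ∫ u in Set.Ioc ε 1, F ω u * kf ε l u) μ :=
    hWFk.integral_prod_left.congr (.of_forall c2)
  simp_rw [c1, c2] at swap
  have hSm : Measurable (fun ω => Sstat ε (V ω)) := (measurable_Sstat ε).comp hV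
  have j0 : Integrable (fun ω => W ω * Real.exp (-l * Sstat ε (V ω))) μ := by
    refine hWi.mul_bdd (c := Real.exp 1)
      (Real.measurable_exp.comp (hSm.const_mul _)).aestronglyMeasurable (.of_forall fun ω => ?_)
    rw [Real.norm_eq_abs, abs_of_pos (Real.exp_pos _)]
    apply Real.exp_le_exp.2
    nlinarith [Sstat_ge ε (V ω) hε (by linarith) (hVr ω)]
  have hhm : ∀ a, Measurable (fun ω => hh ε (P ω a)) := fun a => (measurable_hh ε).comp (hPa a)
  have j3 : Integrable (fun ω => W ω *
      Real.exp (l^2 * Real.log (1/ε) - l/160 * ∑ a, hh ε (P ω a))) μ := by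
    refine hWi.mul_bdd (c := Real.exp (l^2 * Real.log (1/ε)))
      (Real.measurable_exp.comp (measurable_const.sub
        ((Finset.measurable_sum _ fun a _ => hhm a).const_mul _))).aestronglyMeasurable (.of_forall fun ω => ?_)
    rw [Real.norm_eq_abs, abs_of_pos (Real.exp_pos _)]
    apply Real.exp_le_exp.2
    have : 0 ≤ ∑ a, hh ε (P ω a) := Finset.sum_nonneg fun a _ => hh_nonneg _ _ (hp ω a).le
    have : 0 ≤ l/160 * ∑ a, hh ε (P ω a) := by positivity
    linarith
  have jA : Integrable (fun ω => W ω * Phi ε l 1) μ := hWi.mul_const _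
  calc ∫ ω, W ω * Real.exp (-l * Sstat ε (V ω)) ∂μ
      ≤ ∫ ω, (W ω * Phi ε l 1
          + W ω * ((1 - l * Sstat ε (V ω) + l^2 * (Sstat ε (V ω))^2) - Phi ε l 1)) ∂μ := by
        refine integral_mono j0 (jA.add j1) fun ω => ?_
        have h1 := Sstat_ge ε (V ω) hε (by linarith) (hVr ω)
        have h2 := exp_le_quad (-l * Sstat ε (V ω)) (by nlinarith)
        have h3 := mul_le_mul_of_nonneg_left h2 (hW0 ω)
        simp only
        linarith
    _ = ∫ ω, (W ω * Phi ε l 1 + W ω * ∫ u in Set.Ioc ε 1, F ω u * kf ε l u) ∂μ := by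
        rw [integral_add jA j1, integral_add jA j2, swap]
    _ ≤ _ := by
        refine integral_mono (jA.add j2) j3 fun ω => ?_
        simp only
        rw [← mul_add]
        exact mul_le_mul_of_nonneg_left (Q_le ε l hε hε1 hl hl1 (P ω) (hp ω) (hsum ω)) (hW0 ω)

lemma supermart {d n : ℕ} (ε l : ℝ) (hε : 0 < ε) (hε1 : ε ≤ 1/4) (hl : 0 ≤ l)
    (hl1 : l ≤ √ε / 4)
    {Ω : Type*} {m0 : MeasurableSpace Ω} (μ : Measure Ω) [IsProbabilityMeasure μ]
    (ℱ : Filtration ℕ m0)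
    (P : Fin n → Ω → Fin d → ℝ)
    (hP_meas : ∀ t : Fin n, Measurable[ℱ t.val] (P t))
    (hP_pos : ∀ t ω a, 0 < P t ω a) (hP_sum : ∀ t ω, ∑ a, P t ω a = 1)
    (V : Fin n → Ω → ℝ)
    (hV_meas : ∀ t : Fin n, Measurable[ℱ (t.val + 1)] (V t))
    (hV_range : ∀ t ω, V t ω ∈ Set.Icc (0:ℝ) 1)
    (hV_cdf : ∀ t : Fin n, ∀ x ∈ Set.Icc (0:ℝ) 1,
      (μ[(fun ω => if V t ω ≤ x then (1:ℝ) else 0) | ℱ t.val])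
        =ᵐ[μ] fun ω => ∑ a, P t ω a * x ^ (1 / P t ω a))
    (Y : Fin n → Ω → ℝ)
    (hY : ∀ t ω, Y t ω = -l * Sstat ε (V t ω)
      + (l/160 * ∑ a, hh ε (P t ω a) - l^2 * Real.log (1/ε))) :
    Integrable (fun ω => Real.exp (∑ t, Y t ω)) μ ∧ ∫ ω, Real.exp (∑ t, Y t ω) ∂μ ≤ 1 := by
  have hlog : 0 ≤ Real.log (1/ε) := Real.log_nonneg ((one_le_div hε).2 (by linarith))
  have hs0 : 0 < √ε := Real.sqrt_pos.2 hε
  have hHle : ∀ t ω, ∑ a, hh ε (P t ω a) ≤ 1 / √ε := by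
    intro t ω
    rw [← hP_sum t ω, Finset.sum_div]
    exact Finset.sum_le_sum fun a _ => hh_le _ _ hε (hP_pos t ω a).le
  have hBle : ∀ t ω, l/160 * ∑ a, hh ε (P t ω a) - l^2 * Real.log (1/ε) ≤ l/160 * (1/√ε) := by
    intro t ω
    have := mul_le_mul_of_nonneg_left (hHle t ω) (show 0 ≤ l/160 by positivity)
    have : 0 ≤ l^2 * Real.log (1/ε) := by positivity
    linarith
  have hYle : ∀ t ω, Y t ω ≤ l + l/160 * (1/√ε) := by
    intro t ω
    rw [hY]
    have := hBle t ω
    have := Sstat_ge ε (V t ω) hε (by linarith) (hV_range t ω)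
    nlinarith
  have hBm : ∀ t : Fin n, Measurable[ℱ t.val]
      (fun ω => l/160 * ∑ a, hh ε (P t ω a) - l^2 * Real.log (1/ε)) := by
    intro t
    have h1 : ∀ a, Measurable[ℱ t.val] (fun ω => hh ε (P t ω a)) := fun a =>
      (measurable_hh ε).comp ((measurable_pi_apply a).comp (hP_meas t))
    exact ((Finset.measurable_sum _ fun a _ => h1 a).const_mul _).sub_const _
  have hYm : ∀ t : Fin n, Measurable[ℱ (t.val+1)] (Y t) := by
    intro t
    have h2 : Measurable[ℱ (t.val+1)] (fun ω => -l * Sstat ε (V t ω)) :=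
      ((measurable_Sstat ε).comp (hV_meas t)).const_mul _
    have h3 := h2.add ((hBm t).mono (ℱ.mono (Nat.le_succ _)) le_rfl)
    have : Y t = _ := funext (hY t)
    rw [this]
    exact h3
  set W : ℕ → Ω → ℝ := fun t ω => Real.exp (∑ s with s.val < t, Y s ω) with hW
  have hWm : ∀ t, Measurable[ℱ t] (W t) := by
    intro t
    refine Real.measurable_exp.comp (Finset.measurable_sum _ fun s hs => ?_)
    exact (hYm s).mono (ℱ.mono (Finset.mem_filter.1 hs).2) le_rfl
  have hWb : ∀ t, ∃ K, ∀ ω, |W t ω| ≤ K := by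
    intro t
    refine ⟨Real.exp (∑ s : Fin n with s.val < t, (l + l/160 * (1/√ε))), fun ω => ?_⟩
    simp only [hW]
    rw [abs_of_pos (Real.exp_pos _)]
    exact Real.exp_le_exp.2 (Finset.sum_le_sum fun s _ => hYle s ω)
  have hWi : ∀ t, Integrable (W t) μ := fun t => by
    obtain ⟨K, hK⟩ := hWb t
    exact Integrable.of_bound ((hWm t).mono (ℱ.le t) le_rfl).aestronglyMeasurable K (.of_forall hK)
  have hind : ∀ t, t ≤ n → ∫ ω, W t ω ∂μ ≤ 1 := by
    intro t
    induction t with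
    | zero => intro _; simp [hW]
    | succ k ih =>
      intro hk
      have ih := ih (by omega)
      let t : Fin n := ⟨k, hk⟩
      obtain ⟨K, hK⟩ := hWb k
      have hset : (Finset.univ.filter fun s : Fin n => s.val < k + 1)
          = insert t (Finset.univ.filter fun s : Fin n => s.val < k) := by
        ext s
        simp only [Finset.mem_filter, Finset.mem_univ, true_and, Finset.mem_insert, Fin.ext_iff, t]
        omega
      have hnot : t ∉ (Finset.univ.filter fun s : Fin n => s.val < k) := by simp [t]
      have hWs : ∀ ω, W (k+1) ω
          = (W k ω * Real.exp (l/160 * ∑ a, hh ε (P t ω a) - l^2 * Real.log (1/ε)))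
            * Real.exp (-l * Sstat ε (V t ω)) := by
        intro ω
        simp only [hW]
        rw [hset, Finset.sum_insert hnot, ← Real.exp_add, ← Real.exp_add, hY]
        congr 1; ring
      have h1 := one_step (ℱ.le k) μ ε l hε hε1 hl hl1
        (fun ω => W k ω * Real.exp (l/160 * ∑ a, hh ε (P t ω a) - l^2 * Real.log (1/ε)))
        ((hWm k).mul (Real.measurable_exp.comp (hBm t)))
        (K * Real.exp (l/160 * (1/√ε)))
        (fun ω => by
          rw [abs_mul, abs_of_pos (Real.exp_pos (l/160 * _ - _))]
          exact mul_le_mul (hK ω) (Real.exp_le_exp.2 (hBle t ω)) (Real.exp_pos _).le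
            ((abs_nonneg _).trans (hK ω)))
        (fun ω => by positivity)
        (P t) (hP_meas t) (hP_pos t) (hP_sum t) (V t)
        ((hV_meas t).mono (ℱ.le _) le_rfl) (hV_range t) (hV_cdf t)
      simp_rw [hWs]
      refine h1.trans (le_trans (le_of_eq ?_) ih)
      congr 1; funext ω
      rw [mul_assoc, ← Real.exp_add]
      have : l/160 * ∑ a, hh ε (P t ω a) - l^2 * Real.log (1/ε)
        + (l^2 * Real.log (1/ε) - l/160 * ∑ a, hh ε (P t ω a)) = 0 := by ring
      rw [this, Real.exp_zero, mul_one]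
  have hn : ∀ ω, W n ω = Real.exp (∑ t, Y t ω) := by
    intro ω
    simp [hW]
  have h1 := hWi n
  have h2 := hind n le_rfl
  simp_rw [hn] at h2
  exact ⟨h1.congr (.of_forall hn), h2⟩

/-- Under the alternative hypothesis, with `ε = log(1/δ)/n ≤ 1/4`,
`τ = √(2 n log(1/ε) log(1/δ)) + (3/2) log(1/δ)/√ε`, `C = 1920` and any
threshold `τ⋆ ≤ τ`, the probability that `∑_t G_ε(P_t) ≥ C τ` while
`∑_t S_ε(V_t) < τ⋆` is at most `2δ`. -/
theorem detection_failure_prob_le {d n : ℕ} (hd : 0 < d) (hn : 1 ≤ n)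
    (δ ε : ℝ) (hδ : δ ∈ Set.Ioo (0:ℝ) 1)
    (hεdef : ε = Real.log (1/δ) / n) (hε : ε ≤ 1/4)
    {Ω : Type*} {m0 : MeasurableSpace Ω} (μ : Measure Ω) [IsProbabilityMeasure μ]
    (ℱ : Filtration ℕ m0)
    (P : Fin n → Ω → Fin d → ℝ)
    (hP_meas : ∀ t : Fin n, Measurable[ℱ t.val] (P t))
    (hP_pos : ∀ t ω a, 0 < P t ω a) (hP_sum : ∀ t ω, ∑ a, P t ω a = 1)
    (V : Fin n → Ω → ℝ)
    (hV_meas : ∀ t : Fin n, Measurable[ℱ (t.val + 1)] (V t))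
    (hV_range : ∀ t ω, V t ω ∈ Set.Icc (0:ℝ) 1)
    (hV_cdf : ∀ t : Fin n, ∀ x ∈ Set.Icc (0:ℝ) 1,
      (μ[(fun ω => if V t ω ≤ x then (1:ℝ) else 0) | ℱ t.val])
        =ᵐ[μ] fun ω => ∑ a, P t ω a * x ^ (1 / P t ω a))
    (τstar : ℝ)
    (hτstar : τstar ≤ Real.sqrt (2 * n * Real.log (1/ε) * Real.log (1/δ))
                        + (3/2) * Real.log (1/δ) / Real.sqrt ε) :
    μ {ω | 1920 * (Real.sqrt (2 * n * Real.log (1/ε) * Real.log (1/δ))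
                    + (3/2) * Real.log (1/δ) / Real.sqrt ε)
            ≤ ∑ t, Geps ε (P t ω)
          ∧ ∑ t, Sstat ε (V t ω) < τstar}
      ≤ ENNReal.ofReal (2 * δ) := by
  have hδ0 := hδ.1
  set L := Real.log (1/δ) with hL
  have hL0 : 0 < L := Real.log_pos ((one_lt_div hδ0).2 hδ.2)
  have hn0 : (0:ℝ) < n := by exact_mod_cast hn
  have hε0 : 0 < ε := by rw [hεdef]; positivity
  have hLn : L = n * ε := by rw [hεdef]; field_simp
  set ell := Real.log (1/ε) with hell
  have hell1 : 1 ≤ ell := by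
    rw [hell, Real.le_log_iff_exp_le (by positivity), le_div_iff₀ hε0]
    nlinarith [Real.exp_one_lt_d9, Real.exp_pos 1]
  have hs0 : 0 < √ε := Real.sqrt_pos.2 hε0
  have hss : √ε ^ 2 = ε := Real.sq_sqrt hε0.le
  have hr0 : 0 < √ell := Real.sqrt_pos.2 (by linarith)
  have hr1 : 1 ≤ √ell := Real.one_le_sqrt.2 hell1
  have hrr : √ell ^ 2 = ell := Real.sq_sqrt (by linarith)
  set l := √ε / (4 * √ell) with hldef
  have hl0 : 0 < l := by positivity
  have hl1 : l ≤ √ε / 4 := by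
    rw [hldef]
    apply div_le_div_of_nonneg_left hs0.le (by norm_num) (by linarith)
  set τ := √(2 * n * ell * L) + 3/2 * L / √ε with hτ
  have hτ1 : n * √ε ≤ τ := by
    have e : 3/2 * L / √ε = 3/2 * (n * √ε) := by
      rw [hLn, ← hss]; field_simp; rw [Real.sqrt_sq hs0.le]
    have : 0 ≤ √(2 * n * ell * L) := Real.sqrt_nonneg _
    have : 0 < n * √ε := by positivity
    linarith
  have hτ2 : 1.4 * (n * √ε * √ell) ≤ τ := by
    have h1 : 1.4 * (n * √ε * √ell) ≤ √(2 * n * ell * L) := by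
      apply Real.le_sqrt_of_sq_le
      rw [hLn]
      have : (1.4 * (n * √ε * √ell))^2 = 1.96 * (n^2 * ε * ell) := by
        rw [mul_pow, mul_pow, mul_pow, hss, hrr]; norm_num
      rw [this]
      have : 0 ≤ (n:ℝ)^2 * ε * ell := by positivity
      nlinarith
    have : 0 ≤ 3/2 * L / √ε := by positivity
    linarith
  have hlτ : 0.35 * L ≤ l * τ := by
    have := mul_le_mul_of_nonneg_left hτ2 hl0.le
    have e : l * (1.4 * (n * √ε * √ell)) = 0.35 * L := by
      rw [hLn, hldef]; nth_rw 3 [← hss]; field_simp; norm_num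
    linarith
  have hlsq : n * (l^2 * ell) = L / 16 := by
    rw [hLn, hldef, div_pow, mul_pow, hss, hrr]; field_simp; norm_num
  set Y : Fin n → Ω → ℝ := fun t ω => -l * Sstat ε (V t ω)
      + (l/160 * ∑ a, hh ε (P t ω a) - l^2 * Real.log (1/ε)) with hYdef
  obtain ⟨hintg, hle⟩ := supermart ε l hε0 hε hl0.le hl1 μ ℱ P hP_meas hP_pos hP_sum V hV_meas
    hV_range hV_cdf Y (fun t ω => rfl)
  have hsub : {ω | 1920 * τ ≤ ∑ t, Geps ε (P t ω) ∧ ∑ t, Sstat ε (V t ω) < τstar}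
      ⊆ {ω | Real.exp L ≤ Real.exp (∑ t, Y t ω)} := by
    rintro ω ⟨h1, h2⟩
    apply Real.exp_le_exp.2
    have e1 : ∑ t, Y t ω = -l * ∑ t, Sstat ε (V t ω)
        + (l/160 * ∑ t, ∑ a, hh ε (P t ω a)) - n * (l^2 * ell) := by
      simp only [hYdef, Finset.sum_add_distrib, Finset.sum_sub_distrib, ← Finset.mul_sum,
        Finset.sum_const, Finset.card_univ, Fintype.card_fin, nsmul_eq_mul]
      ring
    have e2 : ∑ t, Geps ε (P t ω) ≤ 2 * ∑ t, ∑ a, hh ε (P t ω a) + n * (√ε / 4) := by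
      have := Finset.sum_le_sum fun t (_ : t ∈ Finset.univ) =>
        Geps_le ε hε0 hε (P t ω) (hP_pos t ω) (hP_sum t ω)
      simpa [Finset.sum_add_distrib, ← Finset.mul_sum] using this
    have hτ0 : 0 < τ := lt_of_lt_of_le (by positivity) hτ1
    have e3 : 944 * τ ≤ ∑ t, ∑ a, hh ε (P t ω a) := by linarith
    have e4 := mul_le_mul_of_nonneg_left e3 (show 0 ≤ l/160 by positivity)
    have e5 : l * ∑ t, Sstat ε (V t ω) ≤ l * τ :=
      mul_le_mul_of_nonneg_left (h2.le.trans hτstar) hl0.le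
    rw [e1, hlsq]
    nlinarith
  refine (measure_mono hsub).trans ?_
  have hmk := mul_meas_ge_le_integral_of_nonneg (μ := μ)
    (f := fun ω => Real.exp (∑ t, Y t ω)) (.of_forall fun ω => (Real.exp_pos _).le) hintg (Real.exp L)
  have hexpL : Real.exp L = 1/δ := Real.exp_log (by positivity)
  have hreal : μ.real {ω | Real.exp L ≤ Real.exp (∑ t, Y t ω)} ≤ 2 * δ := by
    have h1 : Real.exp L * μ.real {ω | Real.exp L ≤ Real.exp (∑ t, Y t ω)} ≤ 1 := hmk.trans hle
    rw [hexpL] at h1 ⊢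
    rw [one_div_mul_eq_div, div_le_iff₀ hδ0] at h1
    linarith
  rw [← ENNReal.ofReal_toReal (measure_ne_top μ _)]
  exact ENNReal.ofReal_le_ofReal hreal
end
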